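/- arXiv:2510.13258 — 8 statements merged into one kernel-verified Lean document; each statement's English description precedes it below -/
import Mathlib

section
/- For every n ≥ 1, the number of regions of the hyperplane arrangement K_{2n} equals the number of permutations in G^I_{2n}; that is, r(K_{2n}) = |G^I_{2n}|. -/
/-- The complement in `ℝ^{2n+1}` of the union of the hyperplanes
`x_{2i-1} - x_{2j} = 0` (for `1 ≤ i ≤ j ≤ n`) of the arrangement `K_{2n}`.
Coordinates are 1-indexed: `x_k` is `x ⟨k-1, _⟩`. -/
def KComp (n : ℕ) : Set (Fin (2 * n + 1) → ℝ) :=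
  {x | ∀ i j : ℕ, ∀ _hi : 1 ≤ i, ∀ _hij : i ≤ j, ∀ _hj : j ≤ n,
      x ⟨2 * i - 2, by omega⟩ ≠ x ⟨2 * j - 1, by omega⟩}

/-- A permutation of `{1, …, m}` (one-line notation `π_1 ⋯ π_m`, where the
entry at position `i+1` is `(π i : ℕ) + 1`) belongs to `G^I` if every ascent
is odd–even: whenever `π_i < π_{i+1}`, the entry `π_i` is odd and `π_{i+1}` is even. -/
def IsGI {m : ℕ} (π : Equiv.Perm (Fin m)) : Prop :=
  ∀ i j : Fin m, (i : ℕ) + 1 = (j : ℕ) → π i < π j →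
    Odd ((π i : ℕ) + 1) ∧ Even ((π j : ℕ) + 1)

namespace KGI

def Edge {m : ℕ} (u v : Fin m) : Prop := u < v ∧ Even (u : ℕ) ∧ Odd (v : ℕ)

def Compat {n : ℕ} (x : Fin (2 * n + 1) → ℝ) (π : Equiv.Perm (Fin (2 * n))) : Prop :=
  ∀ u v : Fin (2 * n), Edge u v → (x u.castSucc < x v.castSucc ↔ π.symm u < π.symm v)

lemma mem_KComp {n : ℕ} (x : Fin (2 * n + 1) → ℝ) :
    x ∈ KComp n ↔ ∀ u v : Fin (2 * n), Edge u v → x u.castSucc ≠ x v.castSucc := by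
  constructor
  · intro h u v ⟨h1, h2, h3⟩
    obtain ⟨a, ha⟩ := h2
    obtain ⟨b, hb⟩ := h3
    have h1' : (u : ℕ) < v := h1
    have hv := v.2
    have := h (a + 1) (b + 1) (by omega) (by omega) (by omega)
    convert this using 2
    · ext; simp; omega
    · ext; simp; omega
  · intro h i j hi hij hj
    exact h ⟨2 * i - 2, by omega⟩ ⟨2 * j - 1, by omega⟩
      ⟨by rw [Fin.lt_def]; simp; omega, ⟨i - 1, by simp; omega⟩, ⟨j - 1, by simp; omega⟩⟩

lemma isGI_iff {m : ℕ} (π : Equiv.Perm (Fin m)) :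
    IsGI π ↔ ∀ i j : Fin m, (i : ℕ) + 1 = (j : ℕ) → π i < π j → Edge (π i) (π j) := by
  unfold IsGI Edge
  refine forall_congr' fun i => forall_congr' fun j => forall_congr' fun h =>
    forall_congr' fun h' => ?_
  simp only [h', true_and]
  constructor
  · rintro ⟨⟨a, ha⟩, ⟨b, hb⟩⟩
    exact ⟨⟨a, by omega⟩, ⟨b - 1, by omega⟩⟩
  · rintro ⟨⟨a, ha⟩, ⟨b, hb⟩⟩
    exact ⟨⟨a, by omega⟩, ⟨b + 1, by omega⟩⟩

lemma exists_compat {n : ℕ} (x : Fin (2 * n + 1) → ℝ) (hx : x ∈ KComp n) :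
    ∃ π : Equiv.Perm (Fin (2 * n)), Compat x π := by
  rw [mem_KComp] at hx
  let y : Fin (2 * n) → ℝ := fun u => x u.castSucc
  have hm : Monotone (y ∘ Tuple.sort y) := Tuple.monotone_sort y
  refine ⟨Tuple.sort y, fun u v he => ?_⟩
  have key : ∀ a b, (Tuple.sort y).symm a ≤ (Tuple.sort y).symm b → y a ≤ y b := by
    intro a b h
    simpa using hm h
  constructor
  · intro h
    by_contra h'
    exact absurd (key v u (not_lt.1 h')) (not_le.2 h)
  · intro h
    exact lt_of_le_of_ne (key u v h.le) (hx u v he)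

/-- swapping adjacent non-edge entries keeps compatibility -/
lemma exists_GI {n : ℕ} (x : Fin (2 * n + 1) → ℝ) (hx : x ∈ KComp n) :
    ∃ π : Equiv.Perm (Fin (2 * n)), IsGI π ∧ Compat x π := by
  classical
  obtain ⟨π₀, h₀⟩ := exists_compat x hx
  obtain ⟨π, hπ, hmax⟩ := Set.exists_max_image {π : Equiv.Perm (Fin (2 * n)) | Compat x π}
    (fun π => toLex (π : Fin (2 * n) → Fin (2 * n))) (Set.toFinite _) ⟨π₀, h₀⟩
  refine ⟨π, ?_, hπ⟩
  rw [isGI_iff]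
  intro i j hij hlt
  by_contra hne
  let ρ : Equiv.Perm (Fin (2 * n)) := (Equiv.swap i j).trans π
  have hij' : i < j := by rw [Fin.lt_def]; omega
  have hρ : Compat x ρ := by
    intro u v he
    rw [hπ u v he]
    have e1 : ∀ w, ρ.symm w = Equiv.swap i j (π.symm w) := fun w => by
      simp [ρ]
    rw [e1, e1]
    have hu : π (π.symm u) = u := by simp
    have hv : π (π.symm v) = v := by simp
    generalize π.symm u = p at hu ⊢
    generalize π.symm v = q at hv ⊢
    subst hu hv
    have hpq : ¬ (p = i ∧ q = j) := by rintro ⟨rfl, rfl⟩; exact hne he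
    have hqp : ¬ (p = j ∧ q = i) := by
      rintro ⟨rfl, rfl⟩; exact absurd he.1 (not_lt.2 hlt.le)
    have hne' : p ≠ q := by rintro rfl; exact lt_irrefl _ he.1
    simp only [Equiv.swap_apply_def]
    split_ifs <;> simp only [Fin.lt_def, Fin.ext_iff] at * <;> omega
  have h1 := hmax ρ hρ
  have h2 := Pi.lex_desc (f := (ρ : Fin (2 * n) → Fin (2 * n))) hij'.le
    (by simpa [ρ] using hlt)
  have e : (ρ : Fin (2 * n) → Fin (2 * n)) ∘ Equiv.swap i j = π := by
    ext w; simp [ρ]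
  rw [e] at h2
  exact absurd h1 (not_le.2 h2)

lemma no_factor {m : ℕ} (π : Equiv.Perm (Fin m)) (h : IsGI π) (k l : Fin m) (hkl : k < l)
    (hlt : π k < π l)
    (hE : ∀ p, k ≤ p → p < l → ¬ Edge (π p) (π l) ∧ ¬ Edge (π l) (π p)) : False := by
  classical
  rw [isGI_iff] at h
  obtain ⟨p, ⟨hkp, hpl, hp⟩, hmax⟩ := Set.exists_max_image
    {p : Fin m | k ≤ p ∧ p < l ∧ π p < π l} id (Set.toFinite _) ⟨k, le_rfl, hkl, hlt⟩
  have hpl' : (p : ℕ) < l := hpl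
  let q : Fin m := ⟨p + 1, by omega⟩
  have hql : q ≤ l := by rw [Fin.le_def]; simp [q]; omega
  rcases eq_or_lt_of_le hql with hq | hq
  · exact (hE p hkp hpl).1 (h p l (by rw [← hq]) hp)
  · have hpq : p < q := by rw [Fin.lt_def]; simp [q]
    have hkq : k ≤ q := hkp.trans hpq.le
    have hq2 : ¬ π q < π l := fun hh => absurd (hmax q ⟨hkq, hq, hh⟩) (not_le.2 hpq)
    have hq3 : π l < π q := lt_of_le_of_ne (not_lt.1 hq2) (fun e => hq.ne (π.injective e.symm))
    obtain ⟨_, ho, he⟩ := h p q rfl (hp.trans hq3)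
    rcases Nat.even_or_odd (π l : ℕ) with ha | ha
    · exact (hE q hkq hq).2 ⟨hq3, ha, he⟩
    · exact (hE p hkp hpl).1 ⟨hp, ho, ha⟩

lemma GI_aux {m : ℕ} (π ρ : Equiv.Perm (Fin m)) (hπ : IsGI π)
    (h : ∀ u v, Edge u v → (π.symm u < π.symm v ↔ ρ.symm u < ρ.symm v))
    (k : Fin m) (hk : ∀ i, i < k → π i = ρ i) (hlt : π k < ρ k) : False := by
  obtain ⟨l, hl⟩ := π.surjective (ρ k)
  have hkl : k < l := by
    rcases lt_trichotomy k l with h1 | h1 | h1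
    · exact h1
    · subst h1; rw [hl] at hlt; exact absurd hlt (lt_irrefl _)
    · have := hk l h1
      rw [hl] at this
      exact absurd (ρ.injective this) h1.ne'
  refine no_factor π hπ k l hkl (hl ▸ hlt) ?_
  intro p hkp hpl
  obtain ⟨r, hr⟩ := ρ.surjective (π p)
  have hrk : k < r := by
    rcases lt_trichotomy k r with h1 | h1 | h1
    · exact h1
    · subst h1; rw [← hl] at hr; exact absurd (π.injective hr) hpl.ne'
    · have := hk r h1
      rw [hr] at this
      exact absurd (π.injective this) (h1.trans_le hkp).ne
  have s1 : ρ.symm (π p) = r := by rw [← hr]; simp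
  have s2 : ρ.symm (π l) = k := by rw [hl]; simp
  constructor
  · intro he
    have := (h _ _ he).1 (by simpa using hpl)
    rw [s1, s2] at this
    exact absurd this (not_lt.2 hrk.le)
  · intro he
    have := (h _ _ he).2 (by rw [s1, s2]; exact hrk)
    simp at this
    exact absurd this (not_lt.2 hpl.le)

lemma GI_unique {m : ℕ} (π ρ : Equiv.Perm (Fin m)) (hπ : IsGI π) (hρ : IsGI ρ)
    (h : ∀ u v, Edge u v → (π.symm u < π.symm v ↔ ρ.symm u < ρ.symm v)) : π = ρ := by
  by_contra hne
  have hex : ∃ i, π i ≠ ρ i := by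
    by_contra h'
    push Not at h'
    exact hne (Equiv.ext h')
  obtain ⟨k, hk, hmin⟩ := Set.exists_min_image {i | π i ≠ ρ i} id (Set.toFinite _) hex
  have hlt : ∀ i, i < k → π i = ρ i := fun i hi => by
    by_contra h'
    exact absurd (hmin i h') (not_le.2 hi)
  rcases lt_or_gt_of_ne hk with h1 | h1
  · exact GI_aux π ρ hπ h k hlt h1
  · exact GI_aux ρ π hρ (fun u v he => (h u v he).symm) k (fun i hi => (hlt i hi).symm) h1

lemma same_sign_of_conn {n : ℕ} (x y : KComp n)
    (h : (x : ConnectedComponents (KComp n)) = y) (u v : Fin (2 * n)) (he : Edge u v) :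
    x.1 u.castSucc < x.1 v.castSucc ↔ y.1 u.castSucc < y.1 v.castSucc := by
  have cu : ∀ w : Fin (2 * n + 1), Continuous fun z : KComp n => z.1 w := fun w =>
    (continuous_apply w).comp continuous_subtype_val
  have hc : IsClopen {z : KComp n | z.1 u.castSucc < z.1 v.castSucc} := by
    refine ⟨⟨?_⟩, isOpen_lt (cu _) (cu _)⟩
    have : {z : KComp n | z.1 u.castSucc < z.1 v.castSucc}ᶜ
        = {z : KComp n | z.1 v.castSucc < z.1 u.castSucc} := by
      ext z
      have := (mem_KComp z.1).1 z.2 u v he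
      simp only [Set.mem_compl_iff, Set.mem_setOf_eq, not_lt]
      exact ⟨fun h => lt_of_le_of_ne h this.symm, le_of_lt⟩
    rw [this]
    exact isOpen_lt (cu _) (cu _)
  rw [ConnectedComponents.coe_eq_coe] at h
  constructor
  · intro hx
    exact hc.connectedComponent_subset hx (h ▸ mem_connectedComponent)
  · intro hy
    exact hc.connectedComponent_subset hy (h ▸ mem_connectedComponent)

lemma conn_of_same_sign {n : ℕ} (x y : KComp n)
    (h : ∀ u v : Fin (2 * n), Edge u v →
      (x.1 u.castSucc < x.1 v.castSucc ↔ y.1 u.castSucc < y.1 v.castSucc)) :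
    (x : ConnectedComponents (KComp n)) = y := by
  have hseg : segment ℝ x.1 y.1 ⊆ KComp n := by
    rintro z ⟨a, b, ha, hb, hab, rfl⟩
    rw [mem_KComp]
    intro u v he
    have h1 := (mem_KComp x.1).1 x.2 u v he
    have h2 := (mem_KComp y.1).1 y.2 u v he
    have h3 := h u v he
    simp only [Pi.add_apply, Pi.smul_apply, smul_eq_mul]
    have hb' : b = 1 - a := by linarith
    have ha1 : a ≤ 1 := by linarith
    subst hb'
    rcases lt_or_gt_of_ne h1 with h4 | h4
    · have h5 := h3.1 h4
      apply ne_of_lt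
      rcases eq_or_lt_of_le ha with h6 | h6
      · subst h6; simpa using h5
      · nlinarith
    · have h5 : y.1 v.castSucc < y.1 u.castSucc :=
        lt_of_le_of_ne (not_lt.1 fun hh => absurd (h3.2 hh) (not_lt.2 h4.le)) h2.symm
      apply ne_of_gt
      rcases eq_or_lt_of_le ha with h6 | h6
      · subst h6; simpa using h5
      · nlinarith
  have hpre : IsPreconnected ((↑) ⁻¹' segment ℝ x.1 y.1 : Set (KComp n)) := by
    rw [← Topology.IsInducing.subtypeVal.isPreconnected_image, Subtype.image_preimage_coe,
      Set.inter_eq_right.2 hseg]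
    exact (convex_segment x.1 y.1).isPreconnected
  rw [ConnectedComponents.coe_eq_coe']
  exact hpre.subset_connectedComponent (right_mem_segment ℝ x.1 y.1) (left_mem_segment ℝ x.1 y.1)

end KGI

open KGI in
/-- For every `n ≥ 1`, the number of regions of the hyperplane arrangement
`K_{2n}` equals the number of permutations in `G^I_{2n}`. -/
theorem regions_K_eq_card_GI (n : ℕ) (hn : 1 ≤ n) :
    Nat.card (ConnectedComponents ↥(KComp n)) =
      Nat.card {π : Equiv.Perm (Fin (2 * n)) // IsGI π} := by
  choose f hf hc using fun x : KComp n => exists_GI x.1 x.2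
  have hlift : ∀ c : ConnectedComponents (KComp n), ∃ x : KComp n, (x : ConnectedComponents _) = c :=
    ConnectedComponents.surjective_coe
  choose g hg using hlift
  refine Nat.card_congr (Equiv.ofBijective (fun c => ⟨f (g c), hf (g c)⟩) ⟨?_, ?_⟩)
  · intro c d hcd
    have e : f (g c) = f (g d) := congrArg Subtype.val hcd
    rw [← hg c, ← hg d]
    apply conn_of_same_sign
    intro u v he
    rw [hc (g c) u v he, hc (g d) u v he, e]
  · rintro ⟨π, hπ⟩
    let x : Fin (2 * n + 1) → ℝ := fun w =>
      if h : (w : ℕ) < 2 * n then ((π.symm ⟨w, h⟩ : Fin (2 * n)) : ℕ) else 0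
    have hxv : ∀ u : Fin (2 * n), x u.castSucc = ((π.symm u : Fin (2 * n)) : ℕ) := by
      intro u
      simp [x]
    have hx : x ∈ KComp n := by
      rw [mem_KComp]
      intro u v he h
      rw [hxv, hxv, Nat.cast_inj] at h
      have := π.symm.injective (Fin.ext h)
      exact he.1.ne this
    refine ⟨((⟨x, hx⟩ : KComp n) : ConnectedComponents _), Subtype.ext ?_⟩
    apply GI_unique _ _ (hf _) hπ
    intro u v he
    rw [← hc _ u v he, same_sign_of_conn _ _ (hg _) u v he]
    simp only [hxv, Nat.cast_lt, Fin.lt_def]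
end

section
/- For every n ≥ 1, the number of regions of the hyperplane arrangement K_{2n} equals the number of permutations in G^II_{2n}; that is, r(K_{2n}) = |G^II_{2n}|. -/
/-- A permutation of `{1, …, m}` belongs to `G^II` if:
(a) it has no descent with both entries even;
(b) it has no even–odd ascent nor odd–odd ascent;
(c) every odd–even descent is initial, i.e. occurs at a position `i` with
`π_1 > π_2 > ⋯ > π_i > π_{i+1}` and `π_1, …, π_i` all odd. -/
def IsGII {m : ℕ} (π : Equiv.Perm (Fin m)) : Prop :=
  (∀ i j : Fin m, (i : ℕ) + 1 = (j : ℕ) → π j < π i →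
      ¬(Even ((π i : ℕ) + 1) ∧ Even ((π j : ℕ) + 1))) ∧
  (∀ i j : Fin m, (i : ℕ) + 1 = (j : ℕ) → π i < π j →
      ¬(Even ((π i : ℕ) + 1) ∧ Odd ((π j : ℕ) + 1)) ∧
      ¬(Odd ((π i : ℕ) + 1) ∧ Odd ((π j : ℕ) + 1))) ∧
  (∀ i j : Fin m, (i : ℕ) + 1 = (j : ℕ) → π j < π i →
      Odd ((π i : ℕ) + 1) → Even ((π j : ℕ) + 1) →
      (∀ k l : Fin m, (k : ℕ) + 1 = (l : ℕ) → l ≤ i → π l < π k) ∧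
      (∀ k : Fin m, k ≤ i → Odd ((π k : ℕ) + 1)))

/-- Dependence of letters (0-indexed): `u` codes an odd entry, `v` a larger even entry. -/
def KDep {m : ℕ} (u v : Fin m) : Prop := (u : ℕ) % 2 = 0 ∧ (v : ℕ) % 2 = 1 ∧ (u : ℕ) < v

def KKey {m : ℕ} (u : Fin m) : ℤ := if (u : ℕ) % 2 = 0 then -(u : ℤ) else u

lemma KKey_inj {m : ℕ} : Function.Injective (KKey : Fin m → ℤ) := by
  intro a b h
  unfold KKey at h
  ext
  split_ifs at h <;> omega

/-- Lexicographic normal form. -/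
def KNormal {m : ℕ} (σ : Equiv.Perm (Fin m)) : Prop :=
  ∀ i j : Fin m, i < j →
    (∀ k, i ≤ k → k < j → ¬ KDep (σ j) (σ k) ∧ ¬ KDep (σ k) (σ j)) → KKey (σ i) < KKey (σ j)

lemma fin_down {m : ℕ} (P : Fin m → Prop) (i j : Fin m) (hj : P j)
    (step : ∀ k l : Fin m, (k : ℕ) + 1 = l → i ≤ k → l ≤ j → P l → P k) :
    ∀ k, i ≤ k → k ≤ j → P k := by
  have : ∀ d : ℕ, ∀ k : Fin m, (k : ℕ) + d = j → i ≤ k → P k := by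
    intro d
    induction d with
    | zero =>
      intro k hk _
      have : k = j := Fin.ext (by omega)
      rwa [this]
    | succ d ih =>
      intro k hk hik
      have hlt : (k : ℕ) + 1 < m := by have := j.2; omega
      refine step k ⟨k + 1, hlt⟩ rfl hik ?_ (ih ⟨k + 1, hlt⟩ ?_ ?_)
      · rw [Fin.le_def]; simp only; omega
      · simp only; omega
      · rw [Fin.le_def] at *; simp only; omega
  intro k h1 h2
  exact this (j - k) k (by rw [Fin.le_def] at h2; omega) h1

lemma normal_of_GII {m : ℕ} (σ : Equiv.Perm (Fin m)) (h : IsGII σ) : KNormal σ := by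
  obtain ⟨ha, hb, hc⟩ := h
  simp only [Nat.even_iff, Nat.odd_iff] at ha hb hc
  intro i j hij hcomm
  simp only [KDep] at hcomm
  have hne : ∀ k l : Fin m, (k : ℕ) + 1 = l → (σ k : ℕ) ≠ σ l := by
    intro k l hkl he
    have := σ.injective (Fin.ext he)
    rw [this] at hkl; omega
  have hneij : (σ i : ℕ) ≠ σ j := fun he => hij.ne (σ.injective (Fin.ext he))
  by_cases hp : (σ j : ℕ) % 2 = 0
  · have key := fin_down (fun k => (σ k : ℕ) % 2 = 0 ∧ (σ j : ℕ) ≤ σ k) i j ⟨hp, le_rfl⟩ ?_ i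
      le_rfl hij.le
    · unfold KKey
      rw [if_pos key.1, if_pos hp]; have := key.2; omega
    · rintro k l hkl hik hlj ⟨h1, h2⟩
      have hkj : k < j := by rw [Fin.lt_def]; rw [Fin.le_def] at hlj; omega
      have c := hcomm k hik hkj
      have b := hb k l hkl
      have n := hne k l hkl
      rw [Fin.lt_def] at b
      omega
  · by_cases hi : (σ i : ℕ) % 2 = 0
    · unfold KKey
      rw [if_pos hi, if_neg hp]; omega
    have key := fin_down (fun k => (σ k : ℕ) % 2 = 1 ∧ (σ k : ℕ) ≤ σ j) i j ⟨by omega, le_rfl⟩ ?_ i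
      le_rfl hij.le
    · unfold KKey
      rw [if_neg hi, if_neg hp]; have := key.2; omega
    · rintro k l hkl hik hlj ⟨h1, h2⟩
      have hkj : k < j := by rw [Fin.lt_def]; rw [Fin.le_def] at hlj; omega
      have c := hcomm k hik hkj
      have a := ha k l hkl
      have n := hne k l hkl
      have d := hc k l hkl
      rw [Fin.lt_def] at a d
      by_cases hk : (σ k : ℕ) % 2 = 0
      · have := (d (by omega) (by omega) (by omega)).2 i hik
        omega
      · omega

lemma GII_of_normal {m : ℕ} (σ : Equiv.Perm (Fin m)) (h : KNormal σ) : IsGII σ := by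
  have adj : ∀ i j : Fin m, (i : ℕ) + 1 = j →
      (¬ KDep (σ j) (σ i) ∧ ¬ KDep (σ i) (σ j)) → KKey (σ i) < KKey (σ j) := by
    intro i j hij hc
    refine h i j (by rw [Fin.lt_def]; omega) ?_
    intro k h1 h2
    have : k = i := by rw [Fin.le_def] at h1; rw [Fin.lt_def] at h2; exact Fin.ext (by omega)
    rwa [this]
  have hb : ∀ i j : Fin m, (i : ℕ) + 1 = j → (σ j : ℕ) % 2 = 0 → (σ j : ℕ) < σ i := by
    intro i j hij hj
    by_contra hlt
    have := adj i j hij (by unfold KDep; omega)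
    unfold KKey at this
    split_ifs at this <;> omega
  simp only [IsGII, Nat.even_iff, Nat.odd_iff, Fin.lt_def]
  refine ⟨?_, ?_, ?_⟩
  · rintro i j hij hlt ⟨h1, h2⟩
    have := adj i j hij (by unfold KDep; omega)
    unfold KKey at this
    split_ifs at this <;> omega
  · intro i j hij hlt
    have := hb i j hij
    omega
  · intro i j hij hlt h1 h2
    have hodd : ∀ k : Fin m, k ≤ i → (σ k : ℕ) % 2 = 0 := by
      by_contra hcon
      push Not at hcon
      obtain ⟨k0, hk0, hk0'⟩ := hcon
      have step := fin_down (fun k => (∀ l, k ≤ l → l ≤ i → (σ l : ℕ) % 2 = 0) ∧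
        (∀ l, k ≤ l → l ≤ i → (σ j : ℕ) < σ l)) k0 i ?_ ?_ k0 le_rfl hk0
      · exact hk0' (step.1 k0 le_rfl hk0)
      · refine ⟨?_, ?_⟩ <;> intro l h3 h4 <;> rw [le_antisymm h4 h3] <;> omega
      · rintro k l hkl hk hl ⟨h3, h4⟩
        have e1 := hb k l hkl (h3 l le_rfl hl)
        have e2 := h4 l le_rfl hl
        have hkk : (σ k : ℕ) % 2 = 0 := by
          by_contra hke
          have hkj : k < j := by rw [Fin.lt_def]; rw [Fin.le_def] at hl; omega
          have := h k j hkj ?_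
          · unfold KKey at this
            split_ifs at this <;> omega
          · intro q hq1 hq2
            rw [Fin.le_def] at hq1
            rw [Fin.lt_def] at hq2
            unfold KDep
            by_cases hqk : q = k
            · rw [hqk]; omega
            · have hqk' : (q : ℕ) ≠ k := fun he => hqk (Fin.ext he)
              have h5 : l ≤ q := by rw [Fin.le_def]; omega
              have h6 : q ≤ i := by rw [Fin.le_def]; omega
              have := h3 q h5 h6
              have := h4 q h5 h6
              omega
        refine ⟨?_, ?_⟩
        · intro q hq1 hq2
          by_cases hqk : q = k
          · rw [hqk]; exact hkk
          · have hqk' : (q : ℕ) ≠ k := fun he => hqk (Fin.ext he)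
            rw [Fin.le_def] at hq1
            exact h3 q (by rw [Fin.le_def]; omega) hq2
        · intro q hq1 hq2
          by_cases hqk : q = k
          · rw [hqk]; omega
          · have hqk' : (q : ℕ) ≠ k := fun he => hqk (Fin.ext he)
            rw [Fin.le_def] at hq1
            exact h4 q (by rw [Fin.le_def]; omega) hq2
    refine ⟨?_, fun k hk => by have := hodd k hk; omega⟩
    intro k l hkl hl
    exact hb k l hkl (hodd l hl)

lemma normal_unique {m : ℕ} (π σ : Equiv.Perm (Fin m)) (hπ : KNormal π) (hσ : KNormal σ)
    (h : ∀ u v, KDep u v → (π.symm u < π.symm v ↔ σ.symm u < σ.symm v)) : π = σ := by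
  -- one-sided step
  have main : ∀ (π σ : Equiv.Perm (Fin m)), KNormal σ →
      (∀ u v, KDep u v → (π.symm u < π.symm v ↔ σ.symm u < σ.symm v)) →
      ∀ i, (∀ k < i, π k = σ k) → π i ≠ σ i → KKey (σ i) < KKey (π i) := by
    intro π σ hσ h i hi hne
    obtain ⟨j, hj⟩ := σ.surjective (π i)
    have hij : i < j := by
      rcases lt_trichotomy i j with h1 | h1 | h1
      · exact h1
      · rw [← h1] at hj; exact absurd hj.symm hne
      · have := hi j h1
        rw [hj] at this
        exact absurd (π.injective this) h1.ne
    rw [← hj]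
    refine hσ i j hij ?_
    intro k hik hkj
    obtain ⟨p, hp⟩ := π.surjective (σ k)
    have hip : i < p := by
      rcases lt_trichotomy i p with h1 | h1 | h1
      · exact h1
      · rw [← h1, ← hj] at hp; exact absurd (σ.injective hp) hkj.ne'
      · have := hi p h1
        rw [hp] at this
        have := σ.injective this
        rw [this] at hik
        exact absurd hik (not_le.mpr h1)
    have s1 : π.symm (σ j) = i := by rw [hj]; simp
    have s2 : π.symm (σ k) = p := by rw [← hp]; simp
    refine ⟨fun hd => ?_, fun hd => ?_⟩
    · have := h _ _ hd
      rw [s1, s2] at this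
      simp only [Equiv.symm_apply_apply] at this
      exact absurd (this.1 hip) (not_lt.mpr hkj.le)
    · have := h _ _ hd
      rw [s1, s2] at this
      simp only [Equiv.symm_apply_apply] at this
      exact absurd (this.2 hkj) (not_lt.mpr hip.le)
  have all : ∀ i, π i = σ i := by
    intro i
    induction i using WellFoundedLT.induction with
    | ind i ih =>
      by_contra hne
      have h1 := main π σ hσ h i ih hne
      have h2 := main σ π hπ (fun u v d => (h u v d).symm) i (fun k hk => (ih k hk).symm)
        (Ne.symm hne)
      omega
  exact Equiv.ext all

/-- the move sending position `j` to `i` and shifting the positions in `[i, j)` up -/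
lemma exists_move {m : ℕ} (i j : Fin m) (hij : i < j) : ∃ c : Equiv.Perm (Fin m),
    c j = i ∧ (∀ k < i, c k = k) ∧
    ∀ p q : Fin m, p < q → (¬ (i ≤ p ∧ q = j)) → c p < c q := by
  rw [Fin.lt_def] at hij
  let f : Fin m → Fin m := fun k => if h : k = j then i else
    if h2 : i ≤ k ∧ k < j then ⟨k + 1, by have := j.2; have := h2.2; rw [Fin.lt_def] at this; omega⟩
    else k
  have hf : ∀ k : Fin m, (f k : ℕ) = if (k : ℕ) = j then (i : ℕ) else
      if (i : ℕ) ≤ k ∧ (k : ℕ) < j then (k : ℕ) + 1 else k := by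
    intro k
    simp only [f, Fin.le_def, Fin.lt_def, Fin.ext_iff]
    split_ifs <;> rfl
  have hinj : Function.Injective f := by
    intro a b hab
    have := congrArg Fin.val hab
    rw [hf, hf] at this
    ext
    split_ifs at this <;> omega
  refine ⟨Equiv.ofBijective f (Finite.injective_iff_bijective.mp hinj), ?_, ?_, ?_⟩
  · simp [f]
  · intro k hk
    rw [Fin.lt_def] at hk
    ext
    rw [Equiv.ofBijective_apply, hf]
    split_ifs <;> omega
  · intro p q hpq hn
    rw [Fin.le_def, Fin.ext_iff] at hn
    rw [Fin.lt_def] at hpq ⊢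
    rw [Equiv.ofBijective_apply, Equiv.ofBijective_apply, hf, hf]
    split_ifs <;> omega

lemma exists_normal {m : ℕ} (R : Fin m → Fin m → Prop) (π₀ : Equiv.Perm (Fin m))
    (h₀ : ∀ u v, KDep u v → (π₀.symm u < π₀.symm v ↔ R u v)) :
    ∃ π : Equiv.Perm (Fin m), KNormal π ∧
      ∀ u v, KDep u v → (π.symm u < π.symm v ↔ R u v) := by
  obtain ⟨π, hπ, hmin⟩ := Set.exists_min_image
    {π : Equiv.Perm (Fin m) | ∀ u v, KDep u v → (π.symm u < π.symm v ↔ R u v)}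
    (fun π => toLex (fun i => KKey (π i))) (Set.toFinite _) ⟨π₀, h₀⟩
  refine ⟨π, ?_, hπ⟩
  intro i j hij hc
  by_contra hlt
  have hne : KKey (π j) ≠ KKey (π i) := fun he => hij.ne' (π.injective (KKey_inj he))
  have hlt' : KKey (π j) < KKey (π i) := by omega
  obtain ⟨c, hcj, hcl, hcm⟩ := exists_move i j hij
  have hmem : (c.symm.trans π) ∈
      {π : Equiv.Perm (Fin m) | ∀ u v, KDep u v → (π.symm u < π.symm v ↔ R u v)} := by
    intro u v hd
    rw [← hπ u v hd]
    simp only [Equiv.symm_trans_apply, Equiv.symm_symm]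
    have huv : π.symm u ≠ π.symm v := by
      intro he
      have := π.symm.injective he
      rw [this] at hd
      exact absurd hd.2.2 (lt_irrefl _)
    rcases lt_or_gt_of_ne huv with h1 | h1
    · refine iff_of_true (hcm _ _ h1 ?_) h1
      rintro ⟨h2, h3⟩
      have := (hc _ h2 (h3 ▸ h1)).2
      rw [← h3] at this
      simp at this
      exact this hd
    · refine iff_of_false (not_lt.mpr (hcm _ _ h1 ?_).le) (not_lt.mpr h1.le)
      rintro ⟨h2, h3⟩
      have := (hc _ h2 (h3 ▸ h1)).1
      rw [← h3] at this
      simp at this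
      exact this hd
  have := hmin _ hmem
  refine absurd this (not_le.mpr ?_)
  refine ⟨i, ?_, ?_⟩
  · intro k hk
    have : c.symm k = k := by rw [Equiv.symm_apply_eq, hcl k hk]
    simp [this]
  · have : c.symm i = j := by rw [Equiv.symm_apply_eq, hcj]
    simpa [this] using hlt'

lemma mem_KComp_iff {n : ℕ} (x : Fin (2 * n + 1) → ℝ) :
    x ∈ KComp n ↔ ∀ u v : Fin (2 * n), KDep u v → x u.castSucc ≠ x v.castSucc := by
  constructor
  · rintro h u v ⟨h1, h2, h3⟩
    have := h (u / 2 + 1) (v / 2 + 1) (by omega) (by omega) (by have := v.2; omega)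
    convert this using 2
    · ext; simp only [Fin.val_castSucc]; omega
    · ext; simp only [Fin.val_castSucc]; omega
  · intro h i j hi hij hj
    exact h ⟨2 * i - 2, by omega⟩ ⟨2 * j - 1, by omega⟩ ⟨by simp only; omega, by simp only; omega,
      by simp only; omega⟩

noncomputable def KPoint {n : ℕ} (π : Equiv.Perm (Fin (2 * n))) : Fin (2 * n + 1) → ℝ :=
  Fin.snoc (α := fun _ => ℝ) (fun k => ((π.symm k : ℕ) : ℝ)) 0

lemma KPoint_cs {n : ℕ} (π : Equiv.Perm (Fin (2 * n))) (k : Fin (2 * n)) :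
    KPoint π k.castSucc = ((π.symm k : ℕ) : ℝ) := by
  simp [KPoint]

lemma KPoint_lt {n : ℕ} (π : Equiv.Perm (Fin (2 * n))) (u v : Fin (2 * n)) :
    KPoint π u.castSucc < KPoint π v.castSucc ↔ π.symm u < π.symm v := by
  rw [KPoint_cs, KPoint_cs, Nat.cast_lt, Fin.lt_def]

lemma KPoint_mem {n : ℕ} (π : Equiv.Perm (Fin (2 * n))) : KPoint π ∈ KComp n := by
  rw [mem_KComp_iff]
  intro u v hd he
  rw [KPoint_cs, KPoint_cs, Nat.cast_inj] at he
  have := π.symm.injective (Fin.ext he)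
  rw [this] at hd
  exact absurd hd.2.2 (lt_irrefl _)

lemma comp_eq_iff {n : ℕ} (x y : KComp n) :
    (x : ConnectedComponents (KComp n)) = y ↔
      ∀ u v : Fin (2 * n), KDep u v →
        (x.1 u.castSucc < x.1 v.castSucc ↔ y.1 u.castSucc < y.1 v.castSucc) := by
  constructor
  · intro h u v hd
    have hcont : ∀ w : Fin (2 * n + 1), Continuous (fun z : KComp n => z.1 w) :=
      fun w => (continuous_apply w).comp continuous_subtype_val
    have hcl : IsClopen {z : KComp n | z.1 u.castSucc < z.1 v.castSucc} := by
      refine ⟨?_, isOpen_lt (hcont _) (hcont _)⟩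
      have : {z : KComp n | z.1 u.castSucc < z.1 v.castSucc} =
          {z : KComp n | z.1 u.castSucc ≤ z.1 v.castSucc} := by
        ext z
        have := (mem_KComp_iff z.1).1 z.2 u v hd
        simp only [Set.mem_setOf_eq]
        exact ⟨fun h => le_of_lt h, fun h => lt_of_le_of_ne h this⟩
      rw [this]
      exact isClosed_le (hcont _) (hcont _)
    rw [ConnectedComponents.coe_eq_coe] at h
    constructor
    · intro hx
      exact hcl.connectedComponent_subset hx (h ▸ mem_connectedComponent)
    · intro hy
      exact hcl.connectedComponent_subset hy (h ▸ mem_connectedComponent)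
  · intro h
    rw [ConnectedComponents.coe_eq_coe']
    have hsub : segment ℝ y.1 x.1 ⊆ KComp n := by
      rintro z ⟨a, b, ha, hb, hab, rfl⟩
      rw [mem_KComp_iff]
      intro u v hd
      have hx := (mem_KComp_iff x.1).1 x.2 u v hd
      have hy := (mem_KComp_iff y.1).1 y.2 u v hd
      have huv := h u v hd
      simp only [Pi.add_apply, Pi.smul_apply, smul_eq_mul]
      have gen : ∀ p q r s : ℝ, p < q → r < s → a * p + b * r < a * q + b * s := by
        intro p q r s h1 h2
        rcases ha.eq_or_lt with h3 | h3
        · have : b = 1 := by linarith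
          subst this; rw [← h3]; linarith
        · have := mul_lt_mul_of_pos_left h1 h3
          have := mul_le_mul_of_nonneg_left h2.le hb
          linarith
      rcases lt_or_gt_of_ne hx with h1 | h1
      · exact (gen _ _ _ _ (huv.1 h1) h1).ne
      · refine (gen _ _ _ _ (lt_of_le_of_ne (not_lt.mp fun h2 => ?_) hy.symm) h1).ne'
        exact absurd (huv.2 h2) (not_lt.mpr h1.le)
    have hpre : IsPreconnected (Subtype.val ⁻¹' (segment ℝ y.1 x.1) : Set (KComp n)) := by
      rw [← Topology.IsInducing.subtypeVal.isPreconnected_image, Subtype.image_preimage_coe,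
        Set.inter_eq_right.mpr hsub]
      exact (convex_segment _ _).isPreconnected
    exact hpre.subset_connectedComponent (left_mem_segment ℝ y.1 x.1) (right_mem_segment ℝ y.1 x.1)

/-- For every `n ≥ 1`, the number of regions of the hyperplane arrangement
`K_{2n}` equals the number of permutations in `G^II_{2n}`. -/
theorem regions_K_eq_card_GII (n : ℕ) (hn : 1 ≤ n) :
    Nat.card (ConnectedComponents ↥(KComp n)) =
      Nat.card {π : Equiv.Perm (Fin (2 * n)) // IsGII π} := by
  symm
  refine Nat.card_eq_of_bijective
    (fun π => ((⟨KPoint π.1, KPoint_mem π.1⟩ : KComp n) : ConnectedComponents (KComp n))) ⟨?_, ?_⟩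
  · intro π σ h
    have h := (comp_eq_iff _ _).1 h
    simp only [KPoint_lt] at h
    exact Subtype.ext (normal_unique _ _ (normal_of_GII _ π.2) (normal_of_GII _ σ.2) h)
  · intro y
    obtain ⟨x, rfl⟩ := ConnectedComponents.surjective_coe y
    have hx := (mem_KComp_iff x.1).1 x.2
    let f : Fin (2 * n) → ℝ := fun k => x.1 k.castSucc
    have hm : Monotone (f ∘ Tuple.sort f) := Tuple.monotone_sort f
    obtain ⟨π, h1, h2⟩ := exists_normal (fun u v : Fin (2 * n) => f u < f v) (Tuple.sort f) (by
      intro u v hd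
      constructor
      · intro h
        have := hm h.le
        simp only [Function.comp_apply, Equiv.apply_symm_apply] at this
        exact lt_of_le_of_ne this (hx u v hd)
      · intro h
        by_contra hc
        have := hm (not_lt.mp hc)
        simp only [Function.comp_apply, Equiv.apply_symm_apply] at this
        exact absurd h (not_lt.mpr this))
    refine ⟨⟨π, GII_of_normal π h1⟩, ?_⟩
    refine (comp_eq_iff _ _).2 ?_
    simp only [KPoint_lt]
    exact h2
end

section
/- For every n ≥ 1, the number of regions of the hyperplane arrangement K_{2n} equals the number of permutations in G^III_{2n}; that is, r(K_{2n}) = |G^III_{2n}|. -/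
/-- A permutation of `{1, …, m}` belongs to `G^III` if:
(a) it has no descent with both entries odd and no ascent with both entries even;
(b) there is no pair of positions `i < j` with `π_i` even, all of
`π_{i+1}, …, π_j` odd, and `π_i < π_j` (avoidance of `eO_d` for every `d ≥ 0`). -/
def IsGIII {m : ℕ} (π : Equiv.Perm (Fin m)) : Prop :=
  (∀ i j : Fin m, (i : ℕ) + 1 = (j : ℕ) → π j < π i →
      ¬(Odd ((π i : ℕ) + 1) ∧ Odd ((π j : ℕ) + 1))) ∧
  (∀ i j : Fin m, (i : ℕ) + 1 = (j : ℕ) → π i < π j →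
      ¬(Even ((π i : ℕ) + 1) ∧ Even ((π j : ℕ) + 1))) ∧
  (∀ i j : Fin m, i < j → Even ((π i : ℕ) + 1) →
      (∀ k : Fin m, i < k → k ≤ j → Odd ((π k : ℕ) + 1)) → ¬(π i < π j))

namespace KG

def Adj {m : ℕ} (u v : Fin m) : Prop := (u : ℕ) % 2 = 0 ∧ (v : ℕ) % 2 = 1 ∧ u < v

def rk {m : ℕ} (v : Fin m) : ℕ := if (v : ℕ) % 2 = 0 then v else 3 * m - v

def NF {m : ℕ} (π : Equiv.Perm (Fin m)) : Prop :=
  ∀ i j : Fin m, i < j → rk (π j) < rk (π i) →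
    ∃ k, i ≤ k ∧ k < j ∧ (Adj (π k) (π j) ∨ Adj (π j) (π k))

def Same {m : ℕ} (π σ : Equiv.Perm (Fin m)) : Prop :=
  ∀ u v, Adj u v → (π.symm u < π.symm v ↔ σ.symm u < σ.symm v)

theorem rk_inj {m : ℕ} {u v : Fin m} (h : rk u = rk v) : u = v := by
  unfold rk at h
  apply Fin.ext
  split_ifs at h <;> omega

theorem NF.isGIII {m : ℕ} {π : Equiv.Perm (Fin m)} (h : NF π) : IsGIII π := by
  refine ⟨?_, ?_, ?_⟩
  · rintro i j hij hlt ⟨h1, h2⟩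
    rw [Nat.odd_iff] at h1 h2
    obtain ⟨k, hk1, hk2, hk⟩ := h i j (by rw [Fin.lt_def]; omega)
      (by unfold rk; rw [Fin.lt_def] at hlt; split_ifs <;> omega)
    have : k = i := by apply Fin.ext; rw [Fin.le_def] at hk1; rw [Fin.lt_def] at hk2; omega
    subst this
    rcases hk with hk | hk <;> obtain ⟨a, b, c⟩ := hk <;> omega
  · rintro i j hij hlt ⟨h1, h2⟩
    rw [Nat.even_iff] at h1 h2
    obtain ⟨k, hk1, hk2, hk⟩ := h i j (by rw [Fin.lt_def]; omega)
      (by unfold rk; rw [Fin.lt_def] at hlt; split_ifs <;> omega)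
    have : k = i := by apply Fin.ext; rw [Fin.le_def] at hk1; rw [Fin.lt_def] at hk2; omega
    subst this
    rcases hk with hk | hk <;> obtain ⟨a, b, c⟩ := hk <;> omega
  · intro i j hij h1 h2 hlt
    rw [Nat.even_iff] at h1
    have hj := h2 j hij le_rfl
    rw [Nat.odd_iff] at hj
    obtain ⟨k, hk1, hk2, hk⟩ := h i j hij
      (by unfold rk; rw [Fin.lt_def] at hlt; split_ifs <;> omega)
    rcases eq_or_lt_of_le hk1 with e | e
    · subst e
      rcases hk with hk | hk <;> obtain ⟨a, b, c⟩ := hk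
      · omega
      · exact absurd c (not_lt.2 hlt.le)
    · have := h2 k e hk2.le
      rw [Nat.odd_iff] at this
      rcases hk with hk | hk <;> obtain ⟨a, b, c⟩ := hk <;> omega

theorem odd_run {m : ℕ} {π : Equiv.Perm (Fin m)} (h : IsGIII π) (i : Fin m) (d : ℕ) :
    ∀ (j : Fin m), (j : ℕ) = i + d → (∀ k, i ≤ k → k ≤ j → (π k : ℕ) % 2 = 0) → π i ≤ π j := by
  induction d with
  | zero => intro j hj _; rw [show j = i from Fin.ext (by omega)]
  | succ d ih =>
    intro j hj hk
    let j' : Fin m := ⟨i + d, by omega⟩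
    have hj' : (j' : ℕ) = i + d := rfl
    refine (ih j' hj' (fun k h1 h2 => hk k h1 ?_)).trans ?_
    · rw [Fin.le_def] at *; omega
    · by_contra hc
      have e1 := hk j' (by rw [Fin.le_def]; omega) (by rw [Fin.le_def]; omega)
      have e2 := hk j (by rw [Fin.le_def]; omega) le_rfl
      exact h.1 j' j (by omega) (not_le.1 hc) ⟨by rw [Nat.odd_iff]; omega, by rw [Nat.odd_iff]; omega⟩

theorem even_run {m : ℕ} {π : Equiv.Perm (Fin m)} (h : IsGIII π) (i : Fin m) (d : ℕ) :
    ∀ (j : Fin m), (j : ℕ) = i + d → (∀ k, i ≤ k → k ≤ j → (π k : ℕ) % 2 = 1) → π j ≤ π i := by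
  induction d with
  | zero => intro j hj _; rw [show j = i from Fin.ext (by omega)]
  | succ d ih =>
    intro j hj hk
    let j' : Fin m := ⟨i + d, by omega⟩
    have hj' : (j' : ℕ) = i + d := rfl
    refine le_trans ?_ (ih j' hj' (fun k h1 h2 => hk k h1 ?_))
    · by_contra hc
      have e1 := hk j' (by rw [Fin.le_def]; omega) (by rw [Fin.le_def]; omega)
      have e2 := hk j (by rw [Fin.le_def]; omega) le_rfl
      exact h.2.1 j' j (by omega) (not_le.1 hc)
        ⟨by rw [Nat.even_iff]; omega, by rw [Nat.even_iff]; omega⟩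
    · rw [Fin.le_def] at *; omega

theorem nf_of_isGIII {m : ℕ} {π : Equiv.Perm (Fin m)} (h : IsGIII π) : NF π := by
  intro i j hij hr
  by_contra! hc
  have hne : ∀ k, k < j → (π k : ℕ) ≠ π j := fun k hk e =>
    hk.ne (π.injective (Fin.ext e))
  rcases Nat.mod_two_eq_zero_or_one (π j : ℕ) with hj | hj
  · by_cases hex : ∃ k, (i ≤ k ∧ k < j) ∧ (π k : ℕ) % 2 = 1
    · have hex' : ∃ k, ((i ≤ k ∧ k < j) ∧ (π k : ℕ) % 2 = 1) ∧
          ∀ l, ((i ≤ l ∧ l < j) ∧ (π l : ℕ) % 2 = 1) → k ≤ l → l ≤ k := by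
        obtain ⟨k, hk⟩ := (Finset.univ.filter
          (fun k => (i ≤ k ∧ k < j) ∧ (π k : ℕ) % 2 = 1)).exists_maximal
          (by obtain ⟨k, hk⟩ := hex; exact ⟨k, by simpa using hk⟩)
        exact ⟨k, by simpa using hk.1, fun l hl hkl => hk.2 (by simpa using hl) hkl⟩
      obtain ⟨k, ⟨⟨hik, hkj⟩, hk1⟩, hmax⟩ := hex'
      refine h.2.2 k j hkj (by rw [Nat.even_iff]; omega) (fun l h1 h2 => ?_) ?_
      · rw [Nat.odd_iff]
        rcases eq_or_lt_of_le h2 with e | e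
        · subst e; omega
        · by_contra hl
          exact absurd (hmax l ⟨⟨hik.trans h1.le, e⟩, by omega⟩ h1.le) (not_le.2 h1)
      · by_contra hlt
        exact (hc k hik hkj).2 ⟨hj, hk1, by have := hne k hkj; rw [Fin.lt_def] at *; omega⟩
    · push Not at hex
      have hall : ∀ k, i ≤ k → k ≤ j → (π k : ℕ) % 2 = 0 := by
        intro k h1 h2
        rcases eq_or_lt_of_le h2 with e | e
        · subst e; exact hj
        · have := hex k ⟨h1, e⟩; omega
      have h1 := odd_run h i (j - i) j (by rw [Fin.lt_def] at hij; omega) hall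
      have h2 := hall i le_rfl hij.le
      unfold rk at hr
      rw [Fin.le_def] at h1
      rw [if_pos hj, if_pos h2] at hr
      omega
  · have hi : (π i : ℕ) % 2 = 1 := by
      by_contra hi
      unfold rk at hr
      rw [if_neg (by omega), if_pos (by omega)] at hr
      omega
    have hlt : (π i : ℕ) < π j := by
      unfold rk at hr
      rw [if_neg (by omega), if_neg (by omega)] at hr
      omega
    by_cases hex : ∃ k, (i ≤ k ∧ k < j) ∧ (π k : ℕ) % 2 = 0
    · have hex' : ∃ k, ((i ≤ k ∧ k < j) ∧ (π k : ℕ) % 2 = 0) ∧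
          ∀ l, ((i ≤ l ∧ l < j) ∧ (π l : ℕ) % 2 = 0) → l ≤ k → k ≤ l := by
        obtain ⟨k, hk⟩ := (Finset.univ.filter
          (fun k => (i ≤ k ∧ k < j) ∧ (π k : ℕ) % 2 = 0)).exists_minimal
          (by obtain ⟨k, hk⟩ := hex; exact ⟨k, by simpa using hk⟩)
        exact ⟨k, by simpa using hk.1, fun l hl hkl => hk.2 (by simpa using hl) hkl⟩
      obtain ⟨k, ⟨⟨hik, hkj⟩, hk1⟩, hmin⟩ := hex'
      have hik' : i < k := lt_of_le_of_ne hik (by rintro rfl; omega)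
      have hik2 : (i : ℕ) < k := hik'
      let k' : Fin m := ⟨k - 1, by omega⟩
      have hk' : (k' : ℕ) = k - 1 := rfl
      have hk'k : k' < k := by rw [Fin.lt_def]; omega
      have hall : ∀ l, i ≤ l → l ≤ k' → (π l : ℕ) % 2 = 1 := by
        intro l h1 h2
        have h3 : l < k := lt_of_le_of_lt h2 hk'k
        by_contra hl
        exact absurd (hmin l ⟨⟨h1, h3.trans hkj⟩, by omega⟩ h3.le) (not_le.2 h3)
      have hr1 := even_run h i (k' - i) k' (by omega) hall
      have hk'1 := hall k' (by rw [Fin.le_def]; omega) le_rfl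
      have hkj' : ¬ (π k < π j) := fun hl => (hc k hik hkj).1 ⟨hk1, hj, hl⟩
      refine h.2.2 k' k hk'k (by rw [Nat.even_iff]; omega) (fun l h1 h2 => ?_) ?_
      · have : l = k := by apply Fin.ext; rw [Fin.lt_def] at h1; rw [Fin.le_def] at h2; omega
        subst this
        rw [Nat.odd_iff]; omega
      · rw [Fin.lt_def] at *; rw [Fin.le_def] at hr1; omega
    · push Not at hex
      have hall : ∀ k, i ≤ k → k ≤ j → (π k : ℕ) % 2 = 1 := by
        intro k h1 h2
        rcases eq_or_lt_of_le h2 with e | e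
        · subst e; exact hj
        · have := hex k ⟨h1, e⟩; omega
      have h1 := even_run h i (j - i) j (by rw [Fin.lt_def] at hij; omega) hall
      rw [Fin.le_def] at h1
      omega

theorem Same.symm {m : ℕ} {π σ : Equiv.Perm (Fin m)} (h : Same π σ) : Same σ π :=
  fun u v huv => (h u v huv).symm

theorem uniq_aux {m : ℕ} {π σ : Equiv.Perm (Fin m)} (h1 : NF π) (hs : Same π σ)
    (i : Fin m) (hi : ∀ k < i, π k = σ k) (hr : rk (σ i) < rk (π i)) : False := by
  have key : ∀ (τ ρ : Equiv.Perm (Fin m)), (∀ k < i, τ k = ρ k) → ∀ v, i ≤ τ.symm v → 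
      i ≤ ρ.symm v := by
    intro τ ρ hτ v hv
    by_contra hc
    have := hτ _ (not_le.1 hc)
    rw [Equiv.apply_symm_apply] at this
    rw [← this, Equiv.symm_apply_apply] at hv
    exact hc hv
  set j := π.symm (σ i) with hj
  have hπj : π j = σ i := by simp [hj]
  have hij : i ≤ j := key σ π (fun k hk => (hi k hk).symm) _ (by simp)
  have hij' : i < j := lt_of_le_of_ne hij (by intro e; rw [← e] at hπj; rw [hπj] at hr; omega)
  obtain ⟨k, hk1, hk2, hk⟩ := h1 i j hij' (by rw [hπj]; exact hr)
  have hk3 : i ≤ σ.symm (π k) := key π σ hi _ (by simpa using hk1)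
  rw [hπj] at hk
  have e1 : π.symm (π k) < π.symm (σ i) := by simpa using hk2
  rcases hk with hk | hk
  · have := (hs _ _ hk).1 e1
    rw [Equiv.symm_apply_apply] at this
    exact absurd hk3 (not_le.2 this)
  · have h5 := (hs _ _ hk).2 (lt_of_le_of_ne (by simpa using hk3) (by
      intro e
      have := σ.symm.injective e
      rw [this] at e1
      exact lt_irrefl _ e1))
    exact absurd h5 (not_lt.2 e1.le)

theorem uniq {m : ℕ} {π σ : Equiv.Perm (Fin m)} (h1 : NF π) (h2 : NF σ) (hs : Same π σ) :
    π = σ := by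
  by_contra hne
  have hex : ∃ i, π i ≠ σ i := by
    by_contra! hc
    exact hne (Equiv.ext hc)
  obtain ⟨i, hi, hmin⟩ := WellFounded.has_min (wellFounded_lt (α := Fin m)) {i | π i ≠ σ i} hex
  have hi' : ∀ k < i, π k = σ k := by
    intro k hk
    by_contra hc
    exact hmin k hc hk
  rcases lt_trichotomy (rk (π i)) (rk (σ i)) with h | h | h
  · exact uniq_aux h2 hs.symm i (fun k hk => (hi' k hk).symm) h
  · exact hi (rk_inj h)
  · exact uniq_aux h1 hs i hi' h

theorem exists_nf {m : ℕ} (σ : Equiv.Perm (Fin m)) : ∃ π, NF π ∧ Same π σ := by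
  classical
  obtain ⟨π, hπ, hmin⟩ := Finset.exists_min_image (Finset.univ.filter (fun π => Same π σ))
    (fun π => toLex (fun i => rk (π i))) ⟨σ, Finset.mem_filter.2 ⟨Finset.mem_univ _, fun _ _ _ => Iff.rfl⟩⟩
  have hs : Same π σ := by simpa using hπ
  refine ⟨π, ?_, hs⟩
  intro i j hij hr
  by_contra! hc
  have : NeZero m := ⟨by rintro rfl; exact i.elim0⟩
  set c := Fin.cycleIcc i j with hcdef
  have c1 : ∀ k, k < i → c k = k := fun k hk => Fin.cycleIcc_of_lt hk
  have c2 : ∀ k, j < k → c k = k := fun k hk => Fin.cycleIcc_of_gt hk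
  have c3 : ∀ k, i ≤ k → k < j → (c k : ℕ) = k + 1 := by
    intro k h1 h2
    rw [hcdef, Fin.cycleIcc_of_ge_of_lt h1 h2, Fin.val_add_one_of_lt']
    rw [Fin.lt_def] at h2; omega
  have c4 : c j = i := Fin.cycleIcc_of_last hij.le
  have hc' : ∀ p q, Adj (π p) (π q) → (c p < c q ↔ p < q) := by
    intro p q hpq
    have hpq' : p ≠ q := by rintro rfl; exact lt_irrefl _ hpq.2.2
    have b1 : ¬ (q = j ∧ i ≤ p ∧ p < j) := by
      rintro ⟨rfl, a, b⟩; exact (hc p a b).1 hpq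
    have b2 : ¬ (p = j ∧ i ≤ q ∧ q < j) := by
      rintro ⟨rfl, a, b⟩; exact (hc q a b).2 hpq
    have hv : ∀ k, (k < i ∧ (c k : ℕ) = k) ∨ (j < k ∧ (c k : ℕ) = k) ∨ 
       (i ≤ k ∧ k < j ∧ (c k : ℕ) = k + 1) ∨ (k = j ∧ (c k : ℕ) = i) := by
      intro k
      rcases lt_trichotomy k j with h | h | h
      · rcases lt_or_ge k i with h' | h'
        · exact Or.inl ⟨h', by rw [c1 k h']⟩
        · exact Or.inr (Or.inr (Or.inl ⟨h', h, c3 k h' h⟩))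
      · exact Or.inr (Or.inr (Or.inr ⟨h, by rw [h, c4]⟩))
      · exact Or.inr (Or.inl ⟨h, by rw [c2 k h]⟩)
    have hp := hv p
    have hq := hv q
    clear hv
    simp only [Fin.lt_def, Fin.le_def, Fin.ext_iff, ne_eq] at hp hq b1 b2 hpq' hij ⊢
    omega
  have hmem : Same (π * c⁻¹) σ := by
    intro u v huv
    rw [← hs u v huv]
    have e : ∀ w, (π * c⁻¹).symm w = c (π.symm w) := by
      intro w
      rw [Equiv.symm_apply_eq]
      simp
    rw [e, e]
    exact hc' _ _ (by simpa using huv)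
  have := hmin (π * c⁻¹) (by simpa using hmem)
  refine absurd this (not_le.2 ?_)
  refine ⟨i, ?_, ?_⟩
  · intro k hk
    have : c⁻¹ k = k := by rw [Equiv.Perm.inv_eq_iff_eq, c1 k hk]
    show rk (π (c⁻¹ k)) = rk (π k)
    rw [this]
  · have : c⁻¹ i = j := by rw [Equiv.Perm.inv_eq_iff_eq, c4]
    show rk (π (c⁻¹ i)) < rk (π i)
    rw [this]; exact hr

theorem mem_KComp {n : ℕ} (x : Fin (2 * n + 1) → ℝ) :
    x ∈ KComp n ↔ ∀ u v : Fin (2 * n), Adj u v → x u.castSucc ≠ x v.castSucc := by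
  constructor
  · rintro h u v ⟨h1, h2, h3⟩
    rw [Fin.lt_def] at h3
    have := h (u / 2 + 1) (v / 2 + 1) (by omega) (by omega) (by omega)
    convert this using 2 <;> apply Fin.ext <;> simp <;> omega
  · intro h i j hi hij hj
    exact h ⟨2 * i - 2, by omega⟩ ⟨2 * j - 1, by omega⟩ ⟨by simp only; omega, by simp only; omega,
      by rw [Fin.lt_def]; simp only; omega⟩

theorem same_comp {n : ℕ} (x y : KComp n) :
    (x : ConnectedComponents (KComp n)) = y ↔ ∀ u v : Fin (2 * n), Adj u v →
      (x.1 u.castSucc < x.1 v.castSucc ↔ y.1 u.castSucc < y.1 v.castSucc) := by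
  rw [ConnectedComponents.coe_eq_coe']
  constructor
  · intro h u v huv
    have hco : ∀ w : Fin (2 * n), Continuous (fun z : KComp n => z.1 w.castSucc) :=
      fun w => (continuous_apply _).comp continuous_subtype_val
    have hcl : IsClopen {z : KComp n | z.1 u.castSucc < z.1 v.castSucc} := by
      constructor
      · have : {z : KComp n | z.1 u.castSucc < z.1 v.castSucc} =
            {z : KComp n | z.1 u.castSucc ≤ z.1 v.castSucc} := by
          ext z
          exact ⟨fun h => le_of_lt (Set.mem_setOf.1 h), fun h => lt_of_le_of_ne h ((mem_KComp _).1 z.2 u v huv)⟩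
        rw [this]
        exact isClosed_le (hco u) (hco v)
      · exact isOpen_lt (hco u) (hco v)
    constructor
    · intro hx
      have h' := connectedComponent_eq h
      exact hcl.connectedComponent_subset hx (by rw [← h']; exact mem_connectedComponent)
    · intro hy
      exact hcl.connectedComponent_subset hy h
  · intro h
    have hseg : segment ℝ x.1 y.1 ⊆ KComp n := by
      rintro z ⟨a, b, ha, hb, hab, rfl⟩
      rw [mem_KComp]
      intro u v huv
      have hx := (mem_KComp _).1 x.2 u v huv
      have hy := (mem_KComp _).1 y.2 u v huv
      have hh := h u v huv
      simp only [Pi.add_apply, Pi.smul_apply, smul_eq_mul]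
      rcases lt_or_gt_of_ne hx with h1 | h1
      · have h2 := hh.1 h1
        rcases ha.eq_or_lt with e | e
        · have : b = 1 := by linarith
          subst this; subst e; simpa using h2.ne
        · have := mul_lt_mul_of_pos_left h1 e
          have := mul_le_mul_of_nonneg_left h2.le hb
          intro; linarith
      · have h2 : y.1 v.castSucc < y.1 u.castSucc :=
          lt_of_le_of_ne (not_lt.1 (fun hc => absurd (hh.2 hc) (not_lt.2 h1.le))) hy.symm
        rcases ha.eq_or_lt with e | e
        · have : b = 1 := by linarith
          subst this; subst e; simpa using h2.ne'
        · have := mul_lt_mul_of_pos_left h1 e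
          have := mul_le_mul_of_nonneg_left h2.le hb
          intro; linarith
    have hpre : IsPreconnected ((Subtype.val : KComp n → _) ⁻¹' segment ℝ x.1 y.1) := by
      rw [← Topology.IsInducing.subtypeVal.isPreconnected_image, Subtype.image_preimage_coe,
        Set.inter_eq_right.2 hseg]
      exact (convex_segment _ _).isPreconnected
    exact hpre.subset_connectedComponent (right_mem_segment ℝ x.1 y.1) (left_mem_segment ℝ x.1 y.1)

noncomputable def pt {n : ℕ} (π : Equiv.Perm (Fin (2 * n))) : Fin (2 * n + 1) → ℝ :=
  Fin.snoc (α := fun _ => ℝ) (fun v => ((π.symm v : ℕ) : ℝ)) 0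

theorem pt_cast {n : ℕ} (π : Equiv.Perm (Fin (2 * n))) (v : Fin (2 * n)) :
    pt π v.castSucc = ((π.symm v : ℕ) : ℝ) := by
  simp [pt]

theorem pt_lt {n : ℕ} (π : Equiv.Perm (Fin (2 * n))) (u v : Fin (2 * n)) :
    pt π u.castSucc < pt π v.castSucc ↔ π.symm u < π.symm v := by
  rw [pt_cast, pt_cast, Nat.cast_lt, Fin.lt_def]

theorem pt_mem {n : ℕ} (π : Equiv.Perm (Fin (2 * n))) : pt π ∈ KComp n := by
  rw [mem_KComp]
  intro u v huv e
  rw [pt_cast, pt_cast, Nat.cast_inj] at e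
  have := π.symm.injective (Fin.ext e)
  subst this
  exact lt_irrefl _ huv.2.2

end KG

/-- For every `n ≥ 1`, the number of regions of the hyperplane arrangement
`K_{2n}` equals the number of permutations in `G^III_{2n}`. -/
theorem regions_K_eq_card_GIII (n : ℕ) (hn : 1 ≤ n) :
    Nat.card (ConnectedComponents ↥(KComp n)) =
      Nat.card {π : Equiv.Perm (Fin (2 * n)) // IsGIII π} := by
  symm
  refine Nat.card_eq_of_bijective (fun π : {π : Equiv.Perm (Fin (2 * n)) // IsGIII π} =>
    ((⟨KG.pt π.1, KG.pt_mem π.1⟩ : KComp n) : ConnectedComponents (KComp n))) ⟨?_, ?_⟩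
  · rintro ⟨π, hπ⟩ ⟨σ, hσ⟩ h
    have h := (KG.same_comp _ _).1 h
    apply Subtype.ext
    refine KG.uniq (KG.nf_of_isGIII hπ) (KG.nf_of_isGIII hσ) (fun u v huv => ?_)
    have := h u v huv
    rwa [KG.pt_lt, KG.pt_lt] at this
  · intro c
    obtain ⟨x, rfl⟩ := ConnectedComponents.surjective_coe c
    let f : Fin (2 * n) → ℝ := fun v => x.1 v.castSucc
    obtain ⟨π, hπ, hs⟩ := KG.exists_nf (Tuple.sort f)
    refine ⟨⟨π, hπ.isGIII⟩, (KG.same_comp _ _).2 (fun u v huv => ?_)⟩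
    show KG.pt π _ < KG.pt π _ ↔ _
    rw [KG.pt_lt, hs u v huv]
    have hm := Tuple.monotone_sort f
    have hne : f u ≠ f v := (KG.mem_KComp _).1 x.2 u v huv
    show _ ↔ f u < f v
    constructor
    · intro h
      have := hm h.le
      simp only [Function.comp, Equiv.apply_symm_apply] at this
      exact lt_of_le_of_ne this hne
    · intro h
      by_contra hc
      have := hm (not_lt.1 hc)
      simp only [Function.comp, Equiv.apply_symm_apply] at this
      exact absurd h (not_lt.2 this)
end

section
/- For all n ≥ 1, the number of permutations in G^I_{2n} whose first letter is 1 equals the number of permutations in G^I_{2n} whose first letter is 2; that is, |G^I_{2n,1}| = |G^I_{2n,2}|. -/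
/-- The first letter of the one-line notation of `π` is `k`. -/
def FirstIs {m : ℕ} (π : Equiv.Perm (Fin m)) (k : ℕ) : Prop :=
  ∀ i : Fin m, (i : ℕ) = 0 → (π i : ℕ) + 1 = k

theorem GI_rot_aux {k : ℕ} (hk : 1 ≤ k) (σ π : Equiv.Perm (Fin (k + 1)))
    (h1 : ∀ i j : Fin (k + 1), (i : ℕ) + 1 = (j : ℕ) → π i = σ j)
    (h2 : π (Fin.last k) = σ 0) :
    (IsGI σ ∧ FirstIs σ 2) ↔ (IsGI π ∧ FirstIs π 1) := by
  have one : ((⟨1, by omega⟩ : Fin (k + 1)) : ℕ) = 1 := rfl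
  set a1 : Fin (k + 1) := ⟨1, by omega⟩ with ha1
  have h01 : π 0 = σ a1 := h1 0 a1 (by simp [one])
  constructor
  · rintro ⟨hG, hF⟩
    have hs0 : (σ 0 : ℕ) = 1 := by have := hF 0 (by simp); omega
    have hs1 : (σ a1 : ℕ) = 0 := by
      have hne : σ a1 ≠ σ 0 := fun h => by
        have h := σ.injective h
        rw [h] at one; simp at one
      have hne' : (σ a1 : ℕ) ≠ σ 0 := fun h => hne (Fin.ext h)
      by_contra hc
      have := (hG 0 a1 (by simp [one]) (Fin.lt_def.2 (by omega))).1
      rw [hs0] at this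
      exact absurd this (by decide)
    refine ⟨?_, ?_⟩
    · intro i j hij hlt
      by_cases hj : (j : ℕ) = k
      · have hj' : j = Fin.last k := Fin.ext hj
        have e : (π j : ℕ) = 1 := by rw [hj', h2, hs0]
        have e0 : (π i : ℕ) = 0 := by have := Fin.lt_def.1 hlt; omega
        rw [e, e0]; decide
      · have hjk := j.isLt
        have e2 := h1 j ⟨j + 1, by omega⟩ rfl
        have e1 := h1 i j hij
        rw [e1, e2] at hlt ⊢
        exact hG _ _ rfl hlt
    · intro i hi
      have : i = 0 := Fin.ext hi
      rw [this, h01, hs1]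
  · rintro ⟨hG, hF⟩
    have hp0 : (π 0 : ℕ) = 0 := by have := hF 0 (by simp); omega
    have hl : (π (Fin.last k) : ℕ) = 1 := by
      obtain ⟨p, hp⟩ := π.surjective a1
      have hpv : (π p : ℕ) = 1 := by rw [hp]
      by_cases hpk : (p : ℕ) = k
      · have hl' : p = Fin.last k := Fin.ext hpk
        rw [← hl', hpv]
      · exfalso
        have hplt := p.isLt
        let q : Fin (k + 1) := ⟨p + 1, by omega⟩
        have hq : (q : ℕ) = p + 1 := rfl
        have n0 : (π q : ℕ) ≠ π 0 := fun h => by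
          have := congrArg Fin.val (π.injective (Fin.ext h)); simp [hq] at this
        have n1 : (π q : ℕ) ≠ π p := fun h => by
          have := congrArg Fin.val (π.injective (Fin.ext h)); omega
        have := (hG p q rfl (Fin.lt_def.2 (by omega))).1
        rw [hpv] at this
        exact absurd this (by decide)
    have hs0 : (σ 0 : ℕ) = 1 := by rw [← h2, hl]
    refine ⟨?_, ?_⟩
    · intro i j hij hlt
      have e2 := h1 i j hij
      by_cases hi : (i : ℕ) = 0
      · exfalso
        have hi' : i = 0 := Fin.ext hi
        have : j = a1 := Fin.ext (by omega)
        rw [hi', this, ← h01] at hlt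
        have := Fin.lt_def.1 hlt
        omega
      · have hik := i.isLt
        have e1 := h1 ⟨i - 1, by omega⟩ i (by simp; omega)
        rw [← e1, ← e2] at hlt ⊢
        exact hG _ _ (by simp; omega) hlt
    · intro i hi
      have : i = 0 := Fin.ext hi
      rw [this, hs0]

/-- For all `n ≥ 1`, `|G^I_{2n,1}| = |G^I_{2n,2}|`. -/
theorem card_GI_first_one_eq_first_two (n : ℕ) (hn : 1 ≤ n) :
    Nat.card {π : Equiv.Perm (Fin (2 * n)) // IsGI π ∧ FirstIs π 1} =
      Nat.card {π : Equiv.Perm (Fin (2 * n)) // IsGI π ∧ FirstIs π 2} := by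
  obtain ⟨k, hk, hkm⟩ : ∃ k, 1 ≤ k ∧ 2 * n = k + 1 := ⟨2 * n - 1, by omega, by omega⟩
  rw [hkm]
  symm
  refine Nat.card_congr (Equiv.subtypeEquiv (Equiv.mulRight (finRotate (k + 1))) ?_)
  intro σ
  refine GI_rot_aux hk σ _ ?_ ?_
  · intro i j hij
    have hj := j.isLt
    have : finRotate (k + 1) i = j := by
      apply Fin.ext
      rw [coe_finRotate_of_ne_last, hij]
      intro h
      rw [h] at hij
      simp at hij
      omega
    simp only [Equiv.coe_mulRight, Equiv.Perm.mul_apply, this]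
  · simp only [Equiv.coe_mulRight, Equiv.Perm.mul_apply, finRotate_last]
end

section
/- For all n ≥ 2, |G^I_{2n,3}| = 2(|G^I_{2n,1}| + |G^I_{2n−2,1}|). -/
def GR (a b : ℕ) : Prop := a < b → Odd a ∧ Even b

def LG (m : ℕ) (l : List ℕ) : Prop :=
  l.Nodup ∧ (∀ x, x ∈ l ↔ 1 ≤ x ∧ x ≤ m) ∧ l.IsChain GR

def toL {m : ℕ} (π : Equiv.Perm (Fin m)) : List ℕ := List.ofFn (fun i => (π i : ℕ) + 1)

lemma toL_inj {m : ℕ} : Function.Injective (toL (m := m)) := by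
  intro a b h
  have := List.ofFn_injective h
  ext i
  have := congrFun this i
  simpa using this

lemma toL_spec {m : ℕ} (hm : 0 < m) (k : ℕ) (π : Equiv.Perm (Fin m)) (h : IsGI π ∧ FirstIs π k) :
    LG m (toL π) ∧ (toL π).head? = some k := by
  obtain ⟨h1, h2⟩ := h
  refine ⟨⟨?_, ?_, ?_⟩, ?_⟩
  · rw [toL, List.nodup_ofFn]
    intro i j hij
    have : (π i : ℕ) = π j := by simpa using hij
    exact π.injective (Fin.ext this)
  · intro x
    rw [toL, List.mem_ofFn]
    constructor
    · rintro ⟨i, rfl⟩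
      have := (π i).2
      show 1 ≤ (π i : ℕ) + 1 ∧ (π i : ℕ) + 1 ≤ m
      omega
    · rintro ⟨a, b⟩
      refine ⟨π.symm ⟨x - 1, by omega⟩, ?_⟩
      simp
      omega
  · rw [List.isChain_iff_getElem]
    intro i hi
    simp only [toL, List.length_ofFn] at hi
    simp only [toL, List.getElem_ofFn]
    intro hlt
    exact h1 ⟨i, by omega⟩ ⟨i + 1, hi⟩ rfl (by rw [Fin.lt_def]; omega)
  · have := h2 ⟨0, hm⟩ rfl
    rw [List.head?_eq_getElem?]
    simp [toL, hm, this]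

lemma toL_surj {m : ℕ} (k : ℕ) (l : List ℕ) (h : LG m l) (hk : l.head? = some k) :
    ∃ π : Equiv.Perm (Fin m), (IsGI π ∧ FirstIs π k) ∧ toL π = l := by
  obtain ⟨hn, hx, hc⟩ := h
  have hlen : l.length = m := by
    have : l.toFinset = Finset.Icc 1 m := by
      ext x; simp [hx]
    rw [← List.toFinset_card_of_nodup hn, this]; simp
  have hb : ∀ i (hi : i < l.length), 1 ≤ l[i] ∧ l[i] ≤ m := fun i hi =>
    (hx _).1 (List.getElem_mem hi)
  let f : Fin m → Fin m := fun i => ⟨l[(i : ℕ)]'(by omega) - 1, by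
    have := hb i (by omega); omega⟩
  have hf : Function.Injective f := by
    intro i j hij
    have h1 : l[(i : ℕ)]'(by omega) - 1 = l[(j : ℕ)]'(by omega) - 1 := congrArg Fin.val hij
    have h2 := hb i (by omega)
    have h3 := hb j (by omega)
    have h4 : l[(i : ℕ)]'(by omega) = l[(j : ℕ)]'(by omega) := by omega
    exact Fin.ext ((hn.getElem_inj_iff).1 h4)
  have hv : ∀ i : Fin m, (f i : ℕ) + 1 = l[(i : ℕ)]'(by omega) := by
    intro i
    have := hb i (by omega)
    show l[(i : ℕ)]'(by omega) - 1 + 1 = _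
    omega
  refine ⟨Equiv.ofBijective f (Finite.injective_iff_bijective.1 hf), ⟨?_, ?_⟩, ?_⟩
  · intro i j hij hlt
    simp only [Equiv.ofBijective_apply] at hlt ⊢
    rw [hv, hv]
    have := (List.isChain_iff_getElem.1 hc) i (by omega)
    simp only [hij] at this
    apply this
    rw [← hv, ← hv]
    rw [Fin.lt_def] at hlt
    omega
  · intro i hi
    simp only [Equiv.ofBijective_apply]
    rw [hv]
    rw [List.head?_eq_getElem?] at hk
    simp only [hi]
    exact (List.getElem?_eq_some_iff.1 hk).2
  · apply List.ext_getElem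
    · simp [toL, hlen]
    · intro i h1 h2
      simp only [toL, List.getElem_ofFn, Equiv.ofBijective_apply]
      rw [hv]

lemma card_eq {m : ℕ} (hm : 0 < m) (k : ℕ) :
    Nat.card {π : Equiv.Perm (Fin m) // IsGI π ∧ FirstIs π k} =
      Set.ncard {l : List ℕ | LG m l ∧ l.head? = some k} := by
  have : {l : List ℕ | LG m l ∧ l.head? = some k} =
      toL '' {π : Equiv.Perm (Fin m) | IsGI π ∧ FirstIs π k} := by
    ext l
    constructor
    · rintro ⟨h1, h2⟩
      exact toL_surj k l h1 h2
    · rintro ⟨π, h, rfl⟩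
      exact toL_spec hm k π h
  rw [this, Set.ncard_image_of_injective _ toL_inj]
  rfl

lemma LG_finite (m : ℕ) : {l : List ℕ | LG m l}.Finite := by
  refine ((List.finite_length_le (Fin (m+1)) m).image (List.map Fin.val)).subset ?_
  rintro l ⟨hn, hx, hc⟩
  have hlen : l.length = m := by
    have : l.toFinset = Finset.Icc 1 m := by
      ext x; simp [hx]
    rw [← List.toFinset_card_of_nodup hn, this]; simp
  refine ⟨l.pmap (fun x (hx : x < m + 1) => ⟨x, hx⟩) (fun x h => by have := (hx x).1 h; omega), ?_, ?_⟩
  · simp [hlen]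
  · simp [List.map_pmap]

lemma GR_shift (a b : ℕ) : GR (a + 2) (b + 2) ↔ GR a b := by
  simp [GR, Nat.odd_add, Nat.even_add, parity_simps]

lemma chain_shift (l : List ℕ) : (l.map (· + 2)).IsChain GR ↔ l.IsChain GR := by
  rw [List.isChain_map]
  simp only [GR_shift]

lemma chain_snoc (l : List ℕ) (c : ℕ) (h : ∀ x ∈ l, GR x c) :
    (l ++ [c]).IsChain GR ↔ l.IsChain GR := by
  rw [List.isChain_append]
  constructor
  · exact fun h => h.1
  · intro hc
    refine ⟨hc, by simp, ?_⟩
    intro x hx y hy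
    simp at hy
    subst hy
    exact h x (List.mem_of_getLast? hx)

lemma GR_le {a b : ℕ} (h : b ≤ a) : GR a b := fun h' => by omega

lemma chain_one (v : List ℕ) (hv : ∀ x ∈ v, 2 ≤ x) :
    (1 :: v.map (· + 2)).IsChain GR ↔ (1 :: v).IsChain GR := by
  cases v with
  | nil => simp
  | cons a v =>
    rw [List.map_cons, List.isChain_cons_cons, List.isChain_cons_cons, ← List.map_cons (f := (· + 2)),
      chain_shift]
    have := hv a (by simp)
    simp [GR, parity_simps, show 1 < a by omega]

def HC (w : List ℕ) : Prop := ∃ h, w.head? = some h ∧ (h = 1 ∨ Even h)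

lemma HC_chain (u : List ℕ) (hu : ∀ x ∈ u, 2 ≤ x) (v r : List ℕ) (c : ℕ) (hc : c ≤ 2) :
    (3 :: (u.map (· + 2) ++ c :: r)).IsChain GR ↔
      (u.map (· + 2) ++ c :: r).IsChain GR ∧ HC (u ++ 1 :: v) := by
  cases u with
  | nil => simp [HC, GR_le (show c ≤ 3 by omega)]
  | cons a u =>
    have := hu a (by simp)
    have h3 : GR 3 (a + 2) ↔ Even a := by
      simp only [GR, show 3 < a + 2 by omega, parity_simps]
      simp [show Odd 3 by decide]
    simp only [List.map_cons, List.cons_append, List.isChain_cons_cons, h3, HC]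
    simp [show a ≠ 1 by omega, and_comm]

lemma chainA (u v : List ℕ) (hu : ∀ x ∈ u, 2 ≤ x) (hv : ∀ x ∈ v, 2 ≤ x) :
    (3 :: (u.map (· + 2) ++ 1 :: (v.map (· + 2) ++ [2]))).IsChain GR ↔
      (u ++ 1 :: v).IsChain GR ∧ HC (u ++ 1 :: v) := by
  rw [HC_chain u hu v _ 1 (by omega), List.isChain_split, ← List.cons_append, chain_snoc, chain_snoc,
    chain_shift, chain_one v hv, List.isChain_split (l₁ := u), chain_snoc]
  · intro x hx; exact GR_le (by have := hu x hx; omega)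
  · intro x hx
    simp at hx
    rcases hx with rfl | ⟨a, ha, rfl⟩
    · intro _; decide
    · exact GR_le (by omega)
  · intro x hx
    exact GR_le (by simp at hx; obtain ⟨a, ha, rfl⟩ := hx; omega)

lemma chainB (u v : List ℕ) (hu : ∀ x ∈ u, 2 ≤ x) (hv : ∀ x ∈ v, 2 ≤ x) :
    (3 :: (u.map (· + 2) ++ 2 :: 1 :: v.map (· + 2))).IsChain GR ↔
      (u ++ 1 :: v).IsChain GR ∧ HC (u ++ 1 :: v) := by
  rw [HC_chain u hu v _ 2 (by omega), List.isChain_append_cons_cons, chain_snoc,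
    chain_shift, chain_one v hv, List.isChain_split (l₁ := u), chain_snoc]
  · simp [GR_le (show 1 ≤ 2 by omega)]
  · intro x hx; exact GR_le (by have := hu x hx; omega)
  · intro x hx
    exact GR_le (by simp at hx; obtain ⟨a, ha, rfl⟩ := hx; omega)

lemma memA (m : ℕ) (hm : 1 ≤ m) (u v : List ℕ) (hu : ∀ x ∈ u, 2 ≤ x) (hv : ∀ x ∈ v, 2 ≤ x) :
    (∀ x, x ∈ (3 :: (u.map (· + 2) ++ 1 :: (v.map (· + 2) ++ [2]))) ↔ 1 ≤ x ∧ x ≤ m + 2) ↔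
      (∀ x, x ∈ (u ++ 1 :: v) ↔ 1 ≤ x ∧ x ≤ m) := by
  simp only [List.mem_cons, List.mem_append, List.mem_map, List.not_mem_nil, or_false]
  constructor
  · intro h x
    by_cases hx : x ≤ 1
    · have h1 : x ∉ u := fun h => by have := hu x h; omega
      have h2 : x ∉ v := fun h => by have := hv x h; omega
      simp only [h1, h2, false_or, or_false]; omega
    · have := h (x + 2)
      simp only [Nat.add_right_cancel_iff, exists_eq_right] at this
      grind
  · intro h x
    by_cases hx : x ≤ 3
    · constructor
      · rintro (h | ⟨a, h, rfl⟩ | h | ⟨a, h, rfl⟩ | h) <;> omega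
      · rintro ⟨h1, h2⟩
        have : x = 1 ∨ x = 2 ∨ x = 3 := by omega
        rcases this with rfl | rfl | rfl <;> simp
    · have := h (x - 2)
      obtain ⟨y, rfl⟩ : ∃ y, x = y + 2 := ⟨x - 2, by omega⟩
      simp only [Nat.add_right_cancel_iff, exists_eq_right]
      simp only [Nat.add_sub_cancel] at this
      grind

lemma nodupA (u v : List ℕ) (hu : ∀ x ∈ u, 2 ≤ x) (hv : ∀ x ∈ v, 2 ≤ x) :
    (3 :: (u.map (· + 2) ++ 1 :: (v.map (· + 2) ++ [2]))).Nodup ↔ (u ++ 1 :: v).Nodup := by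
  have h1 : 1 ∉ u := fun h => by have := hu _ h; omega
  have h2 : 1 ∉ v := fun h => by have := hv _ h; omega
  have h3 : 0 ∉ v := fun h => by have := hv _ h; omega
  have hi : Function.Injective (fun x : ℕ => x + 2) := fun a b h => by simpa using h
  simp only [List.nodup_cons, List.nodup_append, List.nodup_map_iff hi, List.mem_cons,
    List.mem_append, List.mem_map]
  grind

lemma permAB (U V : List ℕ) :
    List.Perm (3 :: (U ++ 2 :: 1 :: V)) (3 :: (U ++ 1 :: (V ++ [2]))) := by
  refine List.Perm.cons _ (List.Perm.append_left _ ?_)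
  refine (List.Perm.swap _ _ _).trans (List.Perm.cons _ ?_)
  exact (List.perm_append_singleton 2 V).symm

lemma LG_A (m : ℕ) (hm : 1 ≤ m) (u v : List ℕ) (hu : ∀ x ∈ u, 2 ≤ x) (hv : ∀ x ∈ v, 2 ≤ x) :
    LG (m + 2) (3 :: (u.map (· + 2) ++ 1 :: (v.map (· + 2) ++ [2]))) ↔
      LG m (u ++ 1 :: v) ∧ HC (u ++ 1 :: v) := by
  unfold LG
  rw [memA m hm u v hu hv, nodupA u v hu hv, chainA u v hu hv]
  tauto

lemma LG_B (m : ℕ) (hm : 1 ≤ m) (u v : List ℕ) (hu : ∀ x ∈ u, 2 ≤ x) (hv : ∀ x ∈ v, 2 ≤ x) :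
    LG (m + 2) (3 :: (u.map (· + 2) ++ 2 :: 1 :: v.map (· + 2))) ↔
      LG m (u ++ 1 :: v) ∧ HC (u ++ 1 :: v) := by
  unfold LG
  rw [(permAB _ _).nodup_iff]
  simp only [(permAB _ _).mem_iff]
  rw [memA m hm u v hu hv, nodupA u v hu hv, chainB u v hu hv]
  tauto

lemma LG_C (m : ℕ) (hm : 1 ≤ m) (w : List ℕ) (hw : ∀ x ∈ w, 1 ≤ x) :
    LG (m + 2) (1 :: (w.map (· + 2) ++ [2])) ↔ LG m w ∧ ∃ h, w.head? = some h ∧ Even h := by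
  have hi : Function.Injective (fun x : ℕ => x + 2) := fun a b h => by simpa using h
  have h0 : 0 ∉ w := fun h => by have := hw _ h; omega
  have e1 : (1 :: (w.map (· + 2) ++ [2])).Nodup ↔ w.Nodup := by
    simp only [List.nodup_cons, List.nodup_append, List.nodup_map_iff hi, List.mem_cons,
      List.mem_append, List.mem_map]
    grind
  have e2 : (∀ x, x ∈ (1 :: (w.map (· + 2) ++ [2])) ↔ 1 ≤ x ∧ x ≤ m + 2) ↔
      (∀ x, x ∈ w ↔ 1 ≤ x ∧ x ≤ m) := by
    simp only [List.mem_cons, List.mem_append, List.mem_map, List.not_mem_nil, or_false]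
    constructor
    · intro h x
      have := h (x + 2)
      simp only [Nat.add_right_cancel_iff, exists_eq_right] at this
      grind
    · intro h x
      by_cases hx : x ≤ 2
      · constructor
        · rintro (h | ⟨a, h, rfl⟩ | h) <;> omega
        · rintro ⟨h1, h2⟩
          have : x = 1 ∨ x = 2 := by omega
          rcases this with rfl | rfl <;> simp
      · have := h (x - 2)
        obtain ⟨y, rfl⟩ : ∃ y, x = y + 2 := ⟨x - 2, by omega⟩
        simp only [Nat.add_right_cancel_iff, exists_eq_right]
        simp only [Nat.add_sub_cancel] at this
        grind
  unfold LG
  rw [e1, e2]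
  cases w with
  | nil =>
    have : ¬ (∀ x, x ∈ ([] : List ℕ) ↔ 1 ≤ x ∧ x ≤ m) := by
      intro h; have := (h 1).2 ⟨le_rfl, hm⟩; simp at this
    simp only [this]; simp
  | cons a w =>
    have e3 : (1 :: ((a :: w).map (· + 2) ++ [2])).IsChain GR ↔ (a :: w).IsChain GR ∧ Even a := by
      rw [← chain_shift (a :: w), ← chain_snoc ((a :: w).map (· + 2)) 2]
      · rw [List.map_cons, List.cons_append, List.isChain_cons_cons]
        have : GR 1 (a + 2) ↔ Even a := by
          simp only [GR, show 1 < a + 2 by omega, parity_simps]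
          simp
        rw [this, and_comm]
      · intro x hx
        simp only [List.mem_map] at hx
        obtain ⟨b, hb, rfl⟩ := hx
        exact GR_le (by omega)
    rw [e3]
    simp only [List.head?_cons, Option.some.injEq, exists_eq_left']
    tauto

def mA (w : List ℕ) : List ℕ := 3 :: (w.map (fun x => if x = 1 then 1 else x + 2) ++ [2])
def mB (w : List ℕ) : List ℕ := 3 :: w.flatMap (fun x => if x = 1 then [2, 1] else [x + 2])
def mC (w : List ℕ) : List ℕ := 1 :: (w.map (· + 2) ++ [2])

lemma mA_aux (u : List ℕ) (hu : ∀ x ∈ u, 2 ≤ x) :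
    u.map (fun x => if x = 1 then 1 else x + 2) = u.map (· + 2) := by
  apply List.map_congr_left
  intro a ha
  have := hu a ha
  simp [show a ≠ 1 by omega]

lemma mB_aux (u : List ℕ) (hu : ∀ x ∈ u, 2 ≤ x) :
    u.flatMap (fun x => if x = 1 then [2, 1] else [x + 2]) = u.map (· + 2) := by
  induction u with
  | nil => rfl
  | cons a u ih =>
    have := hu a (by simp)
    rw [List.flatMap_cons, ih (fun x hx => hu x (by simp [hx]))]
    simp [show a ≠ 1 by omega]

lemma mA_eq (u v : List ℕ) (hu : ∀ x ∈ u, 2 ≤ x) (hv : ∀ x ∈ v, 2 ≤ x) :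
    mA (u ++ 1 :: v) = 3 :: (u.map (· + 2) ++ 1 :: (v.map (· + 2) ++ [2])) := by
  simp [mA, mA_aux u hu, mA_aux v hv]

lemma mB_eq (u v : List ℕ) (hu : ∀ x ∈ u, 2 ≤ x) (hv : ∀ x ∈ v, 2 ≤ x) :
    mB (u ++ 1 :: v) = 3 :: (u.map (· + 2) ++ 2 :: 1 :: v.map (· + 2)) := by
  simp [mB, mB_aux u hu, mB_aux v hv]

lemma LG_split {m : ℕ} (hm : 1 ≤ m) {w : List ℕ} (h : LG m w) :
    ∃ u v, w = u ++ 1 :: v ∧ (∀ x ∈ u, 2 ≤ x) ∧ (∀ x ∈ v, 2 ≤ x) := by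
  obtain ⟨hn, hx, hc⟩ := h
  obtain ⟨u, v, rfl⟩ := List.append_of_mem ((hx 1).2 ⟨le_rfl, hm⟩)
  refine ⟨u, v, rfl, ?_, ?_⟩
  · intro x hxu
    have := (hx x).1 (by simp [hxu])
    have : x ≠ 1 := by rintro rfl; simp [List.nodup_append] at hn; grind
    omega
  · intro x hxu
    have := (hx x).1 (by simp [hxu])
    have : x ≠ 1 := by rintro rfl; simp [List.nodup_append] at hn; grind
    omega

lemma unshift (k : ℕ) (U : List ℕ) (h : ∀ x ∈ U, k + 2 ≤ x) :
    ∃ u : List ℕ, U = u.map (· + 2) ∧ ∀ x ∈ u, k ≤ x := by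
  refine ⟨U.map (· - 2), ?_, ?_⟩
  · rw [List.map_map]
    symm
    conv_rhs => rw [← List.map_id U]
    apply List.map_congr_left
    intro a ha
    have := h a ha
    simp; omega
  · intro x hx
    simp only [List.mem_map] at hx
    obtain ⟨a, ha, rfl⟩ := hx
    have := h a ha
    omega

lemma LG_two {m : ℕ} (hm : 1 ≤ m) {l : List ℕ} (h : LG (m + 2) l) :
    ∃ p q, l = p ++ 2 :: q ∧ (q = [] ∨ ∃ q', q = 1 :: q') := by
  obtain ⟨hn, hx, hc⟩ := h
  obtain ⟨u, v, rfl⟩ := List.append_of_mem ((hx 2).2 ⟨by omega, by omega⟩)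
  refine ⟨u, v, rfl, ?_⟩
  cases v with
  | nil => simp
  | cons a v =>
    right
    have h1 := (List.isChain_append_cons_cons.1 hc).2.1
    have h2 := (hx a).1 (by simp)
    have h3 : a ≠ 2 := by rintro rfl; simp [List.nodup_append] at hn
    have h4 : ¬ 2 < a := fun h => by have := (h1 h).1; revert this; decide
    have : a = 1 := by omega
    subst this
    exact ⟨v, rfl⟩

lemma S3_eq (m : ℕ) (hm : 1 ≤ m) : {l : List ℕ | LG (m + 2) l ∧ l.head? = some 3} =
    mA '' {w | LG m w ∧ HC w} ∪ mB '' {w | LG m w ∧ HC w} := by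
  ext l
  constructor
  · rintro ⟨hl, h3⟩
    have hl' := hl
    obtain ⟨p, q, rfl, hq⟩ := LG_two hm hl
    obtain ⟨hn, hx, hc⟩ := hl
    cases p with
    | nil => simp at h3
    | cons a p =>
    simp at h3
    subst h3
    rcases hq with rfl | ⟨V, rfl⟩
    · left
      have h1 : 1 ∈ p := by
        have := (hx 1).2 ⟨by omega, by omega⟩
        simpa using this
      obtain ⟨U, V, rfl⟩ := List.append_of_mem h1
      obtain ⟨u, rfl, hu⟩ := unshift 2 U (by
        intro x hxu
        have := (hx x).1 (by simp [hxu])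
        simp [List.nodup_append] at hn
        clear hx hc hl'
        have e1 : x ≠ 1 := by rintro rfl; grind
        have e2 : x ≠ 2 := by rintro rfl; grind
        have e3 : x ≠ 3 := by rintro rfl; grind
        omega)
      obtain ⟨v, rfl, hv⟩ := unshift 2 V (by
        intro x hxu
        have := (hx x).1 (by simp [hxu])
        simp [List.nodup_append] at hn
        clear hx hc hl'
        have e1 : x ≠ 1 := by rintro rfl; grind
        have e2 : x ≠ 2 := by rintro rfl; grind
        have e3 : x ≠ 3 := by rintro rfl; grind
        omega)
      refine ⟨u ++ 1 :: v, ?_, ?_⟩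
      · rw [Set.mem_setOf_eq, ← LG_A m hm u v hu hv]
        simpa using hl'
      · rw [mA_eq u v hu hv]; simp
    · right
      obtain ⟨u, rfl, hu⟩ := unshift 2 p (by
        intro x hxu
        have := (hx x).1 (by simp [hxu])
        simp [List.nodup_append] at hn
        clear hx hc hl'
        have e1 : x ≠ 1 := by rintro rfl; grind
        have e2 : x ≠ 2 := by rintro rfl; grind
        have e3 : x ≠ 3 := by rintro rfl; grind
        omega)
      obtain ⟨v, rfl, hv⟩ := unshift 2 V (by
        intro x hxu
        have := (hx x).1 (by simp [hxu])
        simp [List.nodup_append] at hn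
        clear hx hc hl'
        have e1 : x ≠ 1 := by rintro rfl; grind
        have e2 : x ≠ 2 := by rintro rfl; grind
        have e3 : x ≠ 3 := by rintro rfl; grind
        omega)
      refine ⟨u ++ 1 :: v, ?_, ?_⟩
      · rw [Set.mem_setOf_eq, ← LG_B m hm u v hu hv]
        simpa using hl'
      · rw [mB_eq u v hu hv]; simp
  · rintro (⟨w, ⟨hw, hh⟩, rfl⟩ | ⟨w, ⟨hw, hh⟩, rfl⟩)
    · obtain ⟨u, v, rfl, hu, hv⟩ := LG_split hm hw
      refine ⟨?_, rfl⟩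
      rw [mA_eq u v hu hv, LG_A m hm u v hu hv]
      exact ⟨hw, hh⟩
    · obtain ⟨u, v, rfl, hu, hv⟩ := LG_split hm hw
      refine ⟨?_, rfl⟩
      rw [mB_eq u v hu hv, LG_B m hm u v hu hv]
      exact ⟨hw, hh⟩

lemma S1_eq (m : ℕ) (hm : 1 ≤ m) : {l : List ℕ | LG (m + 2) l ∧ l.head? = some 1} =
    mC '' {w | LG m w ∧ ∃ h, w.head? = some h ∧ Even h} := by
  ext l
  constructor
  · rintro ⟨hl, h3⟩
    have hl' := hl
    obtain ⟨p, q, rfl, hq⟩ := LG_two hm hl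
    obtain ⟨hn, hx, hc⟩ := hl
    cases p with
    | nil => simp at h3
    | cons a p =>
    simp at h3
    subst h3
    rcases hq with rfl | ⟨V, rfl⟩
    · obtain ⟨u, rfl, hu⟩ := unshift 1 p (by
        intro x hxu
        have := (hx x).1 (by simp [hxu])
        simp [List.nodup_append] at hn
        clear hx hc hl'
        have e1 : x ≠ 1 := by rintro rfl; grind
        have e2 : x ≠ 2 := by rintro rfl; grind
        omega)
      refine ⟨u, ?_, ?_⟩
      · rw [Set.mem_setOf_eq, ← LG_C m hm u hu]
        simpa using hl'
      · simp [mC]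
    · simp [List.nodup_append] at hn
  · rintro ⟨w, ⟨hw, hh⟩, rfl⟩
    refine ⟨?_, rfl⟩
    rw [mC, LG_C m hm w (fun x hx => ((hw.2.1 x).1 hx).1)]
    exact ⟨hw, hh⟩

def mD (l : List ℕ) : List ℕ := ((l.tail).erase 2).map (fun x => if x = 1 then 1 else x - 2)

lemma mD_aux (u : List ℕ) (hu : ∀ x ∈ u, 2 ≤ x) :
    (u.map (· + 2)).map (fun x => if x = 1 then 1 else x - 2) = u := by
  rw [List.map_map]
  conv_rhs => rw [← List.map_id u]
  apply List.map_congr_left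
  intro a ha
  simp

lemma two_notMem (u : List ℕ) (hu : ∀ x ∈ u, 2 ≤ x) : 2 ∉ u.map (· + 2) := by
  intro h
  simp only [List.mem_map] at h
  obtain ⟨a, ha, h⟩ := h
  have := hu a ha
  omega

lemma mDA (u v : List ℕ) (hu : ∀ x ∈ u, 2 ≤ x) (hv : ∀ x ∈ v, 2 ≤ x) :
    mD (mA (u ++ 1 :: v)) = u ++ 1 :: v := by
  rw [mA_eq u v hu hv, mD, List.tail_cons, List.erase_append_right _ (two_notMem u hu),
    List.erase_cons_tail (by simp), List.erase_append_right _ (two_notMem v hv)]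
  simp only [List.map_append, List.map_cons, mD_aux u hu, mD_aux v hv]
  simp

lemma mDB (u v : List ℕ) (hu : ∀ x ∈ u, 2 ≤ x) (hv : ∀ x ∈ v, 2 ≤ x) :
    mD (mB (u ++ 1 :: v)) = u ++ 1 :: v := by
  rw [mB_eq u v hu hv, mD, List.tail_cons, List.erase_append_right _ (two_notMem u hu),
    List.erase_cons_head]
  simp only [List.map_append, List.map_cons, mD_aux u hu, mD_aux v hv]
  simp

lemma mC_inj : Function.Injective mC := by
  intro a b h
  have hi : Function.Injective (fun x : ℕ => x + 2) := fun a b h => by simpa using h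
  simp only [mC, List.cons.injEq, true_and, List.append_cancel_right_eq] at h
  exact (List.map_injective_iff.2 hi) h

lemma main_count (m : ℕ) (hm : 1 ≤ m) :
    Set.ncard {l : List ℕ | LG (m + 2) l ∧ l.head? = some 3} =
    2 * (Set.ncard {l : List ℕ | LG (m + 2) l ∧ l.head? = some 1} +
      Set.ncard {l : List ℕ | LG m l ∧ l.head? = some 1}) := by
  have hfin : {w | LG m w ∧ HC w}.Finite := (LG_finite m).subset (fun x h => h.1)
  have hA : Set.InjOn mA {w | LG m w ∧ HC w} := by
    intro a ha b hb h
    obtain ⟨u, v, rfl, hu, hv⟩ := LG_split hm ha.1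
    obtain ⟨u', v', rfl, hu', hv'⟩ := LG_split hm hb.1
    rw [← mDA u v hu hv, h, mDA u' v' hu' hv']
  have hB : Set.InjOn mB {w | LG m w ∧ HC w} := by
    intro a ha b hb h
    obtain ⟨u, v, rfl, hu, hv⟩ := LG_split hm ha.1
    obtain ⟨u', v', rfl, hu', hv'⟩ := LG_split hm hb.1
    rw [← mDB u v hu hv, h, mDB u' v' hu' hv']
  have hd : Disjoint (mA '' {w | LG m w ∧ HC w}) (mB '' {w | LG m w ∧ HC w}) := by
    rw [Set.disjoint_left]
    rintro l ⟨a, ha, rfl⟩ ⟨b, hb, h⟩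
    obtain ⟨u', v', rfl, hu', hv'⟩ := LG_split hm hb.1
    have h1 : (mA a).getLast? = some 2 := by
      rw [mA, ← List.cons_append, List.getLast?_concat]
    rw [← h, mB_eq u' v' hu' hv'] at h1
    have h2 : 2 ∈ (1 :: v'.map (· + 2)).getLast? := by
      rw [Option.mem_def, ← h1]
      simp [List.getLast?_cons, List.getLast?_append]
    have h3 := List.mem_of_getLast? h2
    have := two_notMem v' hv'
    simp only [List.mem_cons] at h3
    rcases h3 with h3 | h3
    · omega
    · exact this h3
  have hT : {w | LG m w ∧ HC w} = {w | LG m w ∧ ∃ h, w.head? = some h ∧ Even h} ∪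
      {l : List ℕ | LG m l ∧ l.head? = some 1} := by
    ext w
    simp only [HC, Set.mem_setOf_eq, Set.mem_union]
    constructor
    · rintro ⟨h, a, ha, rfl | hb⟩
      · exact Or.inr ⟨h, ha⟩
      · exact Or.inl ⟨h, a, ha, hb⟩
    · rintro (⟨h, a, ha, hb⟩ | ⟨h, ha⟩)
      · exact ⟨h, a, ha, Or.inr hb⟩
      · exact ⟨h, 1, ha, Or.inl rfl⟩
  have hTd : Disjoint {w | LG m w ∧ ∃ h, w.head? = some h ∧ Even h}
      {l : List ℕ | LG m l ∧ l.head? = some 1} := by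
    rw [Set.disjoint_left]
    rintro l ⟨_, a, ha, he⟩ ⟨_, hb⟩
    rw [hb] at ha
    simp at ha
    subst ha
    revert he; decide
  rw [S3_eq m hm, Set.ncard_union_eq hd (hfin.image _) (hfin.image _), Set.ncard_image_of_injOn hA,
    Set.ncard_image_of_injOn hB, S1_eq m hm, Set.ncard_image_of_injective _ mC_inj, hT,
    Set.ncard_union_eq hTd ((LG_finite m).subset (fun x h => h.1))
      ((LG_finite m).subset (fun x h => h.1))]
  ring

/-- For all `n ≥ 2`, `|G^I_{2n,3}| = 2(|G^I_{2n,1}| + |G^I_{2n-2,1}|)`. -/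
theorem card_GI_first_three (n : ℕ) (hn : 2 ≤ n) :
    Nat.card {π : Equiv.Perm (Fin (2 * n)) // IsGI π ∧ FirstIs π 3} =
      2 * (Nat.card {π : Equiv.Perm (Fin (2 * n)) // IsGI π ∧ FirstIs π 1} +
        Nat.card {π : Equiv.Perm (Fin (2 * n - 2)) // IsGI π ∧ FirstIs π 1}) := by
  obtain ⟨m, hm, h2⟩ : ∃ m, 2 ≤ m ∧ 2 * n = m + 2 := ⟨2 * n - 2, by omega, by omega⟩
  rw [card_eq (by omega) 3, card_eq (by omega) 1, card_eq (by omega) 1, h2]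
  exact main_count m (by omega)
end

section
/- For all n ≥ 2, the number of permutations in G^I_{2n} whose first letter is 2n equals the total number of permutations in G^I_{2n−2}; that is, |G^I_{2n,2n}| = |G^I_{2n−2}|. -/
def gExtFun {k : ℕ} (τ : Equiv.Perm (Fin k)) (i : Fin (k + 2)) : Fin (k + 2) :=
  if h : (i : ℕ) < 2 then ⟨k + 1 - i, by omega⟩
  else ⟨τ ⟨i - 2, by omega⟩, by omega⟩

theorem gExtFun_lt {k : ℕ} (τ : Equiv.Perm (Fin k)) (i : Fin (k + 2)) (h : (i : ℕ) < 2) :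
    (gExtFun τ i : ℕ) = k + 1 - i := by simp [gExtFun, h]

theorem gExtFun_ge {k : ℕ} (τ : Equiv.Perm (Fin k)) (i : Fin (k + 2)) (h : ¬ (i : ℕ) < 2) :
    (gExtFun τ i : ℕ) = τ ⟨i - 2, by omega⟩ := by simp [gExtFun, h]

theorem gExtFun_inj {k : ℕ} (τ : Equiv.Perm (Fin k)) : Function.Injective (gExtFun τ) := by
  intro i j hij
  have hv : (gExtFun τ i : ℕ) = gExtFun τ j := by rw [hij]
  apply Fin.ext
  by_cases hi : (i : ℕ) < 2 <;> by_cases hj : (j : ℕ) < 2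
  · rw [gExtFun_lt τ i hi, gExtFun_lt τ j hj] at hv
    omega
  · rw [gExtFun_lt τ i hi, gExtFun_ge τ j hj] at hv
    omega
  · rw [gExtFun_ge τ i hi, gExtFun_lt τ j hj] at hv
    omega
  · rw [gExtFun_ge τ i hi, gExtFun_ge τ j hj] at hv
    have := τ.injective (Fin.ext hv)
    rw [Fin.mk.injEq] at this
    omega

noncomputable def gExt {k : ℕ} (τ : Equiv.Perm (Fin k)) : Equiv.Perm (Fin (k + 2)) :=
  Equiv.ofBijective (gExtFun τ) (Finite.injective_iff_bijective.1 (gExtFun_inj τ))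

theorem gExt_apply {k : ℕ} (τ : Equiv.Perm (Fin k)) (i : Fin (k + 2)) :
    gExt τ i = gExtFun τ i := rfl

theorem gExt_GI {k : ℕ} (τ : Equiv.Perm (Fin k)) (h : IsGI τ) : IsGI (gExt τ) := by
  intro i j hij hlt
  rw [gExt_apply, gExt_apply] at *
  rw [Fin.lt_def] at hlt
  by_cases hi : (i : ℕ) < 2 <;> by_cases hj : (j : ℕ) < 2
  · rw [gExtFun_lt τ i hi, gExtFun_lt τ j hj] at hlt
    omega
  · rw [gExtFun_lt τ i hi, gExtFun_ge τ j hj] at hlt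
    omega
  · omega
  · rw [gExtFun_ge τ i hi, gExtFun_ge τ j hj] at *
    exact h _ _ (by simp only; omega) hlt

theorem gExt_first {k : ℕ} (τ : Equiv.Perm (Fin k)) : FirstIs (gExt τ) (k + 2) := by
  intro i hi
  rw [gExt_apply, gExtFun_lt τ i (by omega)]
  omega

theorem gExt_inj {k : ℕ} : Function.Injective (gExt (k := k)) := by
  intro σ τ h
  ext i
  have h2 : gExt σ ⟨i + 2, by omega⟩ = gExt τ ⟨i + 2, by omega⟩ := by rw [h]
  rw [gExt_apply, gExt_apply, Fin.ext_iff, gExtFun_ge _ _ (by simp),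
    gExtFun_ge _ _ (by simp)] at h2
  simpa using h2

theorem second_eq {k : ℕ} (hk : Even k) (π : Equiv.Perm (Fin (k + 2))) (h : IsGI π)
    (hf : FirstIs π (k + 2)) : (π ⟨1, by omega⟩ : ℕ) = k := by
  obtain ⟨j, hj⟩ := π.surjective ⟨k, by omega⟩
  have h0 := hf ⟨0, by omega⟩ rfl
  have hj0 : (j : ℕ) ≠ 0 := by
    intro h'
    have := hf j h'
    rw [hj] at this
    simp at this
  by_cases hj1 : (j : ℕ) = 1
  · have : j = ⟨1, by omega⟩ := Fin.ext hj1
    rw [← this, hj]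
  · exfalso
    let i : Fin (k + 2) := ⟨j - 1, by omega⟩
    have a : π i ≠ π j := fun e => by
      have := congrArg Fin.val (π.injective e)
      simp only [i] at this
      omega
    have b : π i ≠ π ⟨0, by omega⟩ := fun e => by
      have := congrArg Fin.val (π.injective e)
      simp only [i] at this
      omega
    have a' := Fin.val_ne_of_ne a
    have b' := Fin.val_ne_of_ne b
    have hjv : (π j : ℕ) = k := by rw [hj]
    have hlt : π i < π j := by
      rw [Fin.lt_def]
      have := (π i).isLt
      omega
    have := (h i j (by simp only [i]; omega) hlt).2
    rw [hjv] at this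
    rw [Nat.even_add_one] at this
    exact this hk

theorem gExt_surj {k : ℕ} (hk : Even k) (π : Equiv.Perm (Fin (k + 2))) (h : IsGI π)
    (hf : FirstIs π (k + 2)) : ∃ τ : Equiv.Perm (Fin k), IsGI τ ∧ gExt τ = π := by
  have h0 := hf ⟨0, by omega⟩ rfl
  have h1 := second_eq hk π h hf
  have key : ∀ i : Fin k, (π ⟨i + 2, by omega⟩ : ℕ) < k := by
    intro i
    have a : π ⟨i + 2, by omega⟩ ≠ π ⟨0, by omega⟩ := fun e => by
      have := congrArg Fin.val (π.injective e)
      simp at this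
    have b : π ⟨i + 2, by omega⟩ ≠ π ⟨1, by omega⟩ := fun e => by
      have := congrArg Fin.val (π.injective e)
      simp at this
    have a' := Fin.val_ne_of_ne a
    have b' := Fin.val_ne_of_ne b
    have := (π ⟨i + 2, by omega⟩).isLt
    omega
  let f : Fin k → Fin k := fun i => ⟨π ⟨i + 2, by omega⟩, key i⟩
  have finj : Function.Injective f := by
    intro i j e
    have e1 := congrArg Fin.val e
    have e2 := congrArg Fin.val (π.injective (Fin.ext e1))
    apply Fin.ext
    simpa using e2
  let τ : Equiv.Perm (Fin k) := Equiv.ofBijective f (Finite.injective_iff_bijective.1 finj)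
  refine ⟨τ, ?_, ?_⟩
  · intro i j hij hlt
    exact h ⟨i + 2, by omega⟩ ⟨j + 2, by omega⟩ (by simp only; omega) hlt
  · ext i
    rw [gExt_apply]
    by_cases hi : (i : ℕ) < 2
    · rw [gExtFun_lt _ _ hi]
      have : (i : ℕ) = 0 ∨ (i : ℕ) = 1 := by omega
      rcases this with c | c
      · have := hf i c
        omega
      · have e : i = ⟨1, by omega⟩ := Fin.ext c
        rw [e, h1]
        simp
    · rw [gExtFun_ge _ _ hi]
      change (π ⟨(i : ℕ) - 2 + 2, _⟩ : ℕ) = π i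
      congr 2
      apply Fin.ext
      simp only
      omega

theorem card_aux {k : ℕ} (hk : Even k) :
    Nat.card {π : Equiv.Perm (Fin (k + 2)) // IsGI π ∧ FirstIs π (k + 2)} =
      Nat.card {π : Equiv.Perm (Fin k) // IsGI π} := by
  symm
  refine Nat.card_congr (Equiv.ofBijective
    (fun τ => ⟨gExt τ.1, gExt_GI τ.1 τ.2, gExt_first τ.1⟩) ⟨?_, ?_⟩)
  · intro a b e
    exact Subtype.ext (gExt_inj (congrArg Subtype.val e))
  · rintro ⟨π, h, hf⟩
    obtain ⟨τ, ht, e⟩ := gExt_surj hk π h hf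
    exact ⟨⟨τ, ht⟩, Subtype.ext e⟩

/-- For all `n ≥ 2`, `|G^I_{2n,2n}| = |G^I_{2n-2}|`. -/
theorem card_GI_first_max (n : ℕ) (hn : 2 ≤ n) :
    Nat.card {π : Equiv.Perm (Fin (2 * n)) // IsGI π ∧ FirstIs π (2 * n)} =
      Nat.card {π : Equiv.Perm (Fin (2 * n - 2)) // IsGI π} := by
  obtain ⟨k, rfl⟩ : ∃ k, n = k + 1 := ⟨n - 1, by omega⟩
  exact card_aux (k := 2 * k) (even_two_mul k)
end

section
/- For all n ≥ 1, twice the number of permutations in G^I_{2n} whose first letter is 2n−1 equals the total number of permutations in G^I_{2n}; that is, 2·|G^I_{2n,2n−1}| = Σ_{i=1}^{2n} |G^I_{2n,i}| = |G^I_{2n}|. -/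
theorem cr_val {k : ℕ} (p i : Fin (k+2)) : ((Fin.cycleRange p i : Fin (k+2)) : ℕ) =
    if (i : ℕ) < p then (i : ℕ) + 1 else if (i : ℕ) = p then 0 else i := by
  split_ifs with h1 h2
  · exact Fin.coe_cycleRange_of_lt h1
  · have : i = p := Fin.ext h2
    subst this
    simp
  · rw [Fin.cycleRange_of_gt (by rw [Fin.lt_def]; omega)]

theorem first_iff {k : ℕ} (π : Equiv.Perm (Fin (k+2))) (a : ℕ) :
    FirstIs π a ↔ (π 0 : ℕ) + 1 = a := by
  constructor
  · intro h; exact h 0 rfl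
  · intro h i hi
    have : i = 0 := Fin.ext hi
    rw [this, h]

theorem GI_fwd {k : ℕ} (π : Equiv.Perm (Fin (k+2))) (h : IsGI π)
    (h0 : (π 0 : ℕ) = k) (p : Fin (k+2)) (hp : (π p : ℕ) = k + 1) :
    IsGI (π * Fin.cycleRange p) := by
  intro i j hij hlt
  rw [Equiv.Perm.mul_apply, Equiv.Perm.mul_apply] at *
  have ci := cr_val p i
  have cj := cr_val p j
  generalize Fin.cycleRange p i = a at *
  generalize Fin.cycleRange p j = b at *
  rw [Fin.lt_def] at hlt
  by_cases h1 : (j : ℕ) < p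
  · apply h a b _ hlt
    split_ifs at ci cj <;> omega
  by_cases h2 : (j : ℕ) = p
  · have : a = p := Fin.ext (by split_ifs at ci cj <;> omega)
    rw [this, hp] at hlt
    omega
  by_cases h3 : (i : ℕ) = p
  · have : a = 0 := Fin.ext (by rw [Fin.val_zero]; split_ifs at ci cj <;> omega)
    rw [this, h0] at hlt
    have : b = p := π.injective (Fin.ext (by omega))
    rw [this] at cj
    split_ifs at cj <;> omega
  · apply h a b _ hlt
    split_ifs at ci cj <;> omega

theorem pre_top {k : ℕ} (hk : Even k) (σ : Equiv.Perm (Fin (k+2))) (h : IsGI σ)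
    (p q : Fin (k+2)) (hp : (σ p : ℕ) = k) (hq : (q : ℕ) + 1 = p) : (σ q : ℕ) = k + 1 := by
  by_contra hne
  have hne2 : (σ q : ℕ) ≠ k := fun e => by
    have : q = p := σ.injective (Fin.ext (by omega))
    rw [this] at hq; omega
  have := (h q p hq (by rw [Fin.lt_def]; omega)).2
  rw [hp] at this
  grind

theorem GI_bwd {k : ℕ} (hk : Even k) (σ : Equiv.Perm (Fin (k+2))) (h : IsGI σ)
    (p : Fin (k+2)) (hp : (σ p : ℕ) = k) (hp0 : (p : ℕ) ≠ 0) :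
    IsGI (σ * (Fin.cycleRange p)⁻¹) := by
  intro i j hij hlt
  rw [Equiv.Perm.mul_apply, Equiv.Perm.mul_apply] at *
  have ci := cr_val p ((Fin.cycleRange p)⁻¹ i)
  have cj := cr_val p ((Fin.cycleRange p)⁻¹ j)
  rw [← Equiv.Perm.mul_apply, mul_inv_cancel, Equiv.Perm.one_apply] at ci cj
  generalize (Fin.cycleRange p)⁻¹ i = a at *
  generalize (Fin.cycleRange p)⁻¹ j = b at *
  rw [Fin.lt_def] at hlt
  by_cases h1 : (i : ℕ) = 0
  · have : a = p := Fin.ext (by split_ifs at ci cj <;> omega)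
    rw [this, hp] at hlt ⊢
    have : (σ b : ℕ) = k + 1 := by omega
    rw [this]
    grind
  by_cases h2 : (i : ℕ) = p
  · have := pre_top hk σ h p a hp (by split_ifs at ci cj <;> omega)
    omega
  · apply h a b _ hlt
    split_ifs at ci cj <;> omega

open Classical in
theorem card_half {k : ℕ} (hk : Even k) :
    (Finset.univ.filter fun π : Equiv.Perm (Fin (k+2)) => IsGI π ∧ (π 0 : ℕ) = k).card =
    (Finset.univ.filter fun π : Equiv.Perm (Fin (k+2)) => IsGI π ∧ ¬ (π 0 : ℕ) = k).card := by
  let t : Fin (k+2) := ⟨k+1, by omega⟩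
  let s : Fin (k+2) := ⟨k, by omega⟩
  apply Finset.card_nbij' (fun π => π * Fin.cycleRange (π⁻¹ t))
    (fun σ => σ * (Fin.cycleRange (σ⁻¹ s))⁻¹)
  · intro π hπ
    simp only [Finset.coe_filter, Finset.mem_univ, true_and, Set.mem_ofPred_eq] at hπ ⊢
    have hp : (π (π⁻¹ t) : ℕ) = k + 1 := by simp [t]
    refine ⟨GI_fwd π hπ.1 hπ.2 _ hp, ?_⟩
    rw [Equiv.Perm.mul_apply]
    intro e
    have e2 : Fin.cycleRange (π⁻¹ t) 0 = 0 := π.injective (Fin.ext (by omega))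
    have := cr_val (π⁻¹ t) 0
    rw [e2] at this
    have h0 : π⁻¹ t = 0 := by
      apply Fin.ext
      rw [Fin.val_zero] at *
      split_ifs at this <;> omega
    rw [h0] at hp
    omega
  · intro σ hσ
    simp only [Finset.coe_filter, Finset.mem_univ, true_and, Set.mem_ofPred_eq] at hσ ⊢
    have hp : (σ (σ⁻¹ s) : ℕ) = k := by simp [s]
    refine ⟨GI_bwd hk σ hσ.1 _ hp ?_, ?_⟩
    · intro e
      have : σ⁻¹ s = 0 := Fin.ext e
      rw [this] at hp
      exact hσ.2 hp
    · have : (Fin.cycleRange (σ⁻¹ s))⁻¹ 0 = σ⁻¹ s := by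
        rw [Equiv.Perm.inv_eq_iff_eq]; simp
      rw [Equiv.Perm.mul_apply, this, hp]
  · intro π hπ
    simp only [Finset.coe_filter, Finset.mem_univ, true_and, Set.mem_ofPred_eq] at hπ ⊢
    have h0 : π 0 = s := Fin.ext hπ.2
    have : (π * Fin.cycleRange (π⁻¹ t))⁻¹ s = π⁻¹ t := by
      rw [Equiv.Perm.inv_eq_iff_eq, Equiv.Perm.mul_apply, Fin.cycleRange_self, h0]
    rw [this, mul_inv_cancel_right]
  · intro σ hσ
    simp only [Finset.coe_filter, Finset.mem_univ, true_and, Set.mem_ofPred_eq] at hσ ⊢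
    have hp : (σ (σ⁻¹ s) : ℕ) = k := by simp [s]
    have hp0 : (σ⁻¹ s : Fin (k+2)).val ≠ 0 := by
      intro e
      have : σ⁻¹ s = 0 := Fin.ext e
      rw [this] at hp
      exact hσ.2 hp
    have hlt := (σ⁻¹ s).isLt
    let q : Fin (k+2) := ⟨(σ⁻¹ s).val - 1, by omega⟩
    have hq : (σ q : ℕ) = k + 1 := pre_top hk σ hσ.1 _ q hp (by simp only [q]; omega)
    have : (σ * (Fin.cycleRange (σ⁻¹ s))⁻¹)⁻¹ t = σ⁻¹ s := by
      rw [mul_inv_rev, inv_inv, Equiv.Perm.mul_apply]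
      have : σ⁻¹ t = q := by
        rw [Equiv.Perm.inv_eq_iff_eq]; exact Fin.ext hq.symm
      rw [this]
      apply Fin.ext
      rw [cr_val]
      simp only [q]
      split_ifs <;> omega
    rw [this, inv_mul_cancel_right]

/-- For all `n ≥ 1`,
`2·|G^I_{2n,2n-1}| = Σ_{i=1}^{2n} |G^I_{2n,i}| = |G^I_{2n}|`. -/
theorem card_GI_first_submax (n : ℕ) (hn : 1 ≤ n) :
    2 * Nat.card {π : Equiv.Perm (Fin (2 * n)) // IsGI π ∧ FirstIs π (2 * n - 1)} =
      (∑ i ∈ Finset.Icc 1 (2 * n),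
        Nat.card {π : Equiv.Perm (Fin (2 * n)) // IsGI π ∧ FirstIs π i}) ∧
    (∑ i ∈ Finset.Icc 1 (2 * n),
        Nat.card {π : Equiv.Perm (Fin (2 * n)) // IsGI π ∧ FirstIs π i}) =
      Nat.card {π : Equiv.Perm (Fin (2 * n)) // IsGI π} := by
  classical
  obtain ⟨k, hk, hk2⟩ : ∃ k, Even k ∧ 2 * n = k + 2 := ⟨2 * n - 2, by grind, by omega⟩
  rw [hk2]
  have hs : (∑ i ∈ Finset.Icc 1 (k+2),
        Nat.card {π : Equiv.Perm (Fin (k+2)) // IsGI π ∧ FirstIs π i}) =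
      Nat.card {π : Equiv.Perm (Fin (k+2)) // IsGI π} := by
    simp only [Nat.card_eq_fintype_card, Fintype.card_subtype, first_iff]
    rw [Finset.card_eq_sum_card_fiberwise (f := fun π : Equiv.Perm (Fin (k+2)) => (π 0 : ℕ) + 1)
      (t := Finset.Icc 1 (k+2))]
    · simp only [Finset.filter_filter]
    · intro π _
      have := (π 0).isLt
      simp only [Finset.coe_Icc, Set.mem_Icc]
      omega
  refine ⟨?_, hs⟩
  rw [hs]
  simp only [Nat.card_eq_fintype_card, Fintype.card_subtype, first_iff]
  have h1 : ∀ π : Equiv.Perm (Fin (k+2)), ((π 0 : ℕ) + 1 = k + 2 - 1) ↔ (π 0 : ℕ) = k := by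
    intro π; omega
  simp only [h1]
  have h2 := Finset.card_filter_add_card_filter_not
    (s := Finset.univ.filter fun π : Equiv.Perm (Fin (k+2)) => IsGI π) (fun π => (π 0 : ℕ) = k)
  simp only [Finset.filter_filter] at h2
  rw [← h2, ← card_half hk, two_mul]
end

section
/- For all n ≥ 1 and all 1 ≤ k ≤ n, the number of permutations in G^I_{2n} whose first letter is 2k equals the Seidel triangle entry S(2n, n+1−k); that is, |G^I_{2n,2k}| = S(2n, n+1−k). -/
namespace Seid
abbrev V := ℕ → ℤ

def Eu : Module.End ℤ V where
  toFun H := fun d => d * H d + d * H (d - 1)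
  map_add' := by intros; ext d; simp; ring
  map_smul' := by intros; ext d; simp; ring
def Ou : Module.End ℤ V where
  toFun H := fun d => d * H d + d * H (d + 1)
  map_add' := by intros; ext d; simp; ring
  map_smul' := by intros; ext d; simp; ring
def Em : Module.End ℤ V where
  toFun H := fun d => (d + 1) * H d + d * H (d - 1)
  map_add' := by intros; ext d; simp; ring
  map_smul' := by intros; ext d; simp; ring
def Om : Module.End ℤ V where
  toFun H := fun d => (d + 1) * H d + (d + 1) * H (d + 1)
  map_add' := by intros; ext d; simp; ring
  map_smul' := by intros; ext d; simp; ring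

lemma Eu_apply (H : V) (d : ℕ) : Eu H d = d * H d + d * H (d - 1) := rfl
lemma Ou_apply (H : V) (d : ℕ) : Ou H d = d * H d + d * H (d + 1) := rfl
lemma Em_apply (H : V) (d : ℕ) : Em H d = (d + 1) * H d + d * H (d - 1) := rfl
lemma Om_apply (H : V) (d : ℕ) : Om H d = (d + 1) * H d + (d + 1) * H (d + 1) := rfl

lemma ext_op {P Q : Module.End ℤ V} (h : ∀ H d, P H d = Q H d) : P = Q :=
  LinearMap.ext fun H => funext fun d => h H d

lemma id1 : Em * Om = Ou * Eu + Om := by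
  apply ext_op
  intro H d
  rcases d with _ | d <;>
    simp only [Module.End.mul_apply, LinearMap.add_apply, Pi.add_apply, Eu_apply, Ou_apply,
      Em_apply, Om_apply, Nat.add_sub_cancel] <;> push_cast <;> ring

lemma id2 : (Ou * Eu) * Om + Om * Om + Ou * Eu = Om * (Ou * Eu) := by
  apply ext_op
  intro H d
  rcases d with _ | d <;>
    simp only [Module.End.mul_apply, LinearMap.add_apply, Pi.add_apply, Eu_apply, Ou_apply,
      Om_apply, Nat.add_sub_cancel] <;> push_cast <;> ring

def de : V := fun d => if d = 0 then 1 else 0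

lemma Om_de : Om de = de := by
  ext d
  rcases d with _ | d <;> simp [Om_apply, de]

def a (i j : ℕ) : ℤ := (((Om * Em) ^ i * Om * (Ou * Eu) ^ j) de) 0

lemma a00 : a 0 0 = 1 := by simp [a, Om_de]; simp [de]

lemma idAX : (Om * Em) * Om = Om * (Ou * Eu) + Om * Om := by
  rw [mul_assoc, id1, mul_add]

lemma F1 (i : ℕ) : a (i + 1) 0 = a i 1 + a i 0 := by
  have h : (Om * Em) ^ (i + 1) * Om = (Om * Em) ^ i * Om * (Ou * Eu) + (Om * Em) ^ i * Om * Om := by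
    rw [pow_succ, mul_assoc, idAX]; noncomm_ring
  simp only [a, pow_zero, mul_one, pow_one]
  rw [h, LinearMap.add_apply, Module.End.mul_apply (_ * Om) Om, Om_de]; rfl

lemma F2 (i j : ℕ) : a (i + 2) j + a i (j + 2) + a i (j + 1) = 2 * a (i + 1) (j + 1) := by
  have h : (Om * Em) * ((Om * Em) * Om) + Om * (Ou * Eu) * (Ou * Eu) + Om * (Ou * Eu)
      = 2 * ((Om * Em) * Om * (Ou * Eu)) := by
    have e2 := congrArg (fun z => Om * z) id2
    have e3 := congrArg (fun z => z * Om) idAX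
    have e4 := congrArg (fun z => z * (Ou * Eu)) idAX
    simp only [mul_add, add_mul] at e2 e3 e4
    have L : (Om * Em) * ((Om * Em) * Om)
        = (Om * Em) * Om * (Ou * Eu) + (Om * (Ou * Eu) * Om + Om * Om * Om) := by
      rw [← e3]
      conv_lhs => rw [idAX]
      rw [mul_add]; simp only [mul_assoc]
    rw [L, two_mul]
    conv_rhs => rw [e4, mul_assoc Om Om (Ou * Eu), ← e2]
    rw [e4]
    simp only [mul_assoc]
    rw [show Om * (Om * (Ou * Eu)) = Om * (Ou * (Eu * Om)) + Om * (Om * Om) + Om * (Ou * Eu) by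
      rw [← e2]; simp only [mul_assoc]]
    abel
  have h2 := congrArg (fun z : Module.End ℤ V => (((Om * Em) ^ i * z * (Ou * Eu) ^ j) de) 0) h
  simp only [two_mul, mul_add, add_mul, LinearMap.add_apply, Pi.add_apply] at h2 
  simp only [a, two_mul]
  have q1 : (Om * Em) ^ (i + 2) * Om * (Ou * Eu) ^ j
    = (Om * Em) ^ i * (Om * Em * (Om * Em * Om)) * (Ou * Eu) ^ j := by
    rw [pow_add, pow_two]; simp only [mul_assoc]
  have q2 : (Om * Em) ^ i * Om * (Ou * Eu) ^ (j+2)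
    = (Om * Em) ^ i * (Om * (Ou * Eu) * (Ou * Eu)) * (Ou * Eu) ^ j := by
    rw [pow_succ', pow_succ']; simp only [mul_assoc]
  have q3 : (Om * Em) ^ i * Om * (Ou * Eu) ^ (j+1)
    = (Om * Em) ^ i * (Om * (Ou * Eu)) * (Ou * Eu) ^ j := by
    rw [pow_succ']; simp only [mul_assoc]
  have q4 : (Om * Em) ^ (i + 1) * Om * (Ou * Eu) ^ (j+1)
    = (Om * Em) ^ i * (Om * Em * Om * (Ou * Eu)) * (Ou * Eu) ^ j := by
    rw [pow_succ (Om * Em), pow_succ' (Ou * Eu)]; simp only [mul_assoc]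
  rw [q1, q2, q3, q4]
  exact h2

lemma F3 (j : ℕ) : a 1 j = 2 * a 0 (j + 1) := by
  simp only [a, pow_one, pow_zero, one_mul]
  rw [pow_succ']
  generalize (Ou * Eu) ^ j = P
  simp only [Module.End.mul_apply, Eu_apply, Ou_apply, Em_apply, Om_apply]
  push_cast
  ring

theorem seidel_eq
    (S : ℕ → ℕ → ℕ)
    (hS1 : S 1 1 = 1)
    (hS0 : ∀ r, 1 ≤ r → S r 0 = 0)
    (hStop : ∀ r k, 1 ≤ r → r + 1 < 2 * k → S r k = 0)
    (hSeven : ∀ m k, 1 ≤ m → 1 ≤ k →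
      S (2 * m) k = S (2 * m - 1) k + S (2 * m) (k + 1))
    (hSodd : ∀ m k, 1 ≤ m → 1 ≤ k → k ≤ m + 1 →
      S (2 * m + 1) k = S (2 * m) k + S (2 * m + 1) (k - 1)) (n : ℕ) :
    ∀ i j, i + j = n → a i j = S (2 * (n + 1)) (j + 1) := by
  induction n with
  | zero =>
    intro i j h
    obtain ⟨rfl, rfl⟩ : i = 0 ∧ j = 0 := by omega
    have h1 := hSeven 1 1 le_rfl le_rfl
    have h2 := hStop 2 2 (by norm_num) (by norm_num)
    simp at h1
    simp [a00, h1, hS1, h2]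
  | succ n ih =>
    have key : ∀ j i, i + 1 + j = n + 1 → a (i + 1) j - a i (j + 1) = S (2 * (n + 1) + 1) (j + 1) := by
      intro j
      induction j with
      | zero =>
        intro i h
        have := hSodd (n + 1) 1 (by omega) le_rfl (by omega)
        simp [hS0] at this
        rw [F1]; simp [this]
        have := ih i 0 (by omega)
        rw [this]
      | succ j ihj =>
        intro i h
        have h1 := ihj (i + 1) (by omega)
        have h2 := F2 i j
        have h3 := ih i (j + 1) (by omega)
        have h4 := hSodd (n + 1) (j + 2) (by omega) (by omega) (by omega)
        simp at h4
        push_cast [h4]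
        rw [show j + 1 + 1 = j + 2 from rfl] at *
        linarith
    have key0 : a 0 (n + 1) = S (2 * (n + 1) + 1) (n + 2) := by
      have h4 := hSodd (n + 1) (n + 2) (by omega) (by omega) (by omega)
      have h5 := hStop (2 * (n + 1)) (n + 2) (by omega) (by omega)
      have h6 := key n 0 (by omega)
      have h7 := F3 n
      simp at h4
      simp at h6
      rw [h4, h5]
      push_cast
      linarith
    intro i
    induction i with
    | zero =>
      intro j h
      obtain rfl : j = n + 1 := by omega
      have h1 := hSeven (n + 2) (n + 2) (by omega) (by omega)
      have h2 := hStop (2 * (n + 2)) (n + 3) (by omega) (by omega)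
      rw [key0]
      rw [show n + 1 + 1 = n + 2 from rfl, h1, h2]
      rfl
    | succ i ihi =>
      intro j h
      have h0 := ihi (j + 1) (by omega)
      have h1 := hSeven (n + 2) (j + 1) (by omega) (by omega)
      have h2 := key j i (by omega)
      rw [show n + 1 + 1 = n + 2 from rfl] at *
      rw [show 2 * (n + 2) - 1 = 2 * (n + 1) + 1 by omega] at h1
      rw [h1]; push_cast; linarith
end Seid

namespace Seid

def r (x y : ℕ) : Prop := y < x ∨ (x < y ∧ (Odd x ∨ x = 0) ∧ Even y)

def Cfg (K : ℕ) (T : Multiset ℕ) (c : ℕ) : Set (List ℕ) :=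
  {w | (w : Multiset ℕ) = Multiset.replicate c 0 + T ∧ w.getLast? = some 0 ∧ (K :: w).IsChain r}

lemma fin_lists (s : Multiset ℕ) : {w : List ℕ | (w : Multiset ℕ) = s}.Finite := by
  induction s using Quotient.inductionOn with
  | _ l =>
    refine (l.permutations.toFinset.finite_toSet).subset ?_
    intro w hw
    have : w.Perm l := Quotient.exact hw
    simpa using this

lemma Cfg_fin (K T c) : (Cfg K T c).Finite := (fin_lists _).subset fun _ h => h.1

/-- zero positions -/
def Z (w : List ℕ) : Finset ℕ := (Finset.range w.length).filter (fun i => w[i]? = some 0)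

lemma card_Z (w : List ℕ) : (Z w).card = w.count 0 := by
  induction w with
  | nil => rfl
  | cons x w ih =>
    have : Z (x :: w) = (if x = 0 then {0} else ∅) ∪ (Z w).map ⟨Nat.succ, Nat.succ_injective⟩ := by
      ext i
      rcases i with _ | i
      · by_cases hx : x = 0 <;> simp [Z, hx]
      · by_cases hx : x = 0 <;> simp [Z, hx]
    rw [this, Finset.card_union_of_disjoint]
    · rw [Finset.card_map, ih]
      by_cases hx : x = 0 <;> simp [hx, add_comm]
    · by_cases hx : x = 0 <;> simp [hx]

def spl (w : List ℕ) : Set (List ℕ × List ℕ) := {p | p.1 ++ 0 :: p.2 = w}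

lemma spl_image (w : List ℕ) (q : ℕ → Prop) :
    {p ∈ spl w | q p.1.length} = (fun i => (w.take i, w.drop (i + 1))) '' {i ∈ (Z w : Set ℕ) | q i} := by
  ext ⟨A, B⟩
  constructor
  · rintro ⟨h, hq⟩
    simp only [spl, Set.mem_ofPred_eq] at h
    subst h
    refine ⟨A.length, ⟨by simp [Z], hq⟩, ?_⟩
    simp
  · rintro ⟨i, ⟨hi, hq⟩, h⟩
    simp only [Z, Finset.coe_filter, Finset.mem_range, Set.mem_ofPred_eq] at hi
    simp only [Prod.mk.injEq] at h
    obtain ⟨rfl, rfl⟩ := h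
    obtain ⟨h1, h2⟩ := hi
    refine ⟨?_, by simpa [Nat.min_eq_left h1.le] using hq⟩
    simp only [spl, Set.mem_ofPred_eq]
    rw [List.getElem?_eq_getElem h1, Option.some_inj] at h2
    rw [← h2, List.getElem_cons_drop, List.take_append_drop]

lemma spl_ncard (w : List ℕ) (q : ℕ → Prop) :
    {p ∈ spl w | q p.1.length}.ncard = {i ∈ (Z w : Set ℕ) | q i}.ncard := by
  rw [spl_image]
  apply Set.InjOn.ncard_image
  rintro i ⟨hi, -⟩ j ⟨hj, -⟩ h
  simp only [Z, Finset.coe_filter, Finset.mem_range, Set.mem_ofPred_eq] at hi hj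
  simp only [Prod.mk.injEq] at h
  have := congrArg List.length h.1
  simp at this
  omega

lemma spl_fin (w : List ℕ) : (spl w).Finite := by
  have := spl_image w (fun _ => True)
  simp only [and_true, Set.ofPred_mem_eq] at this
  rw [this]
  exact (Finset.finite_toSet _).image _

def PS (C : Set (List ℕ)) (q : List ℕ × List ℕ → Prop) : Set (List ℕ × List ℕ) :=
  {p | p.1 ++ 0 :: p.2 ∈ C ∧ q p}

lemma PS_fin {C : Set (List ℕ)} (hC : C.Finite) (q) : (PS C q).Finite := by
  refine (hC.biUnion (t := spl) fun w _ => spl_fin w).subset ?_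
  rintro p ⟨h1, -⟩
  simp only [Set.mem_iUnion]
  exact ⟨_, h1, rfl⟩

lemma PS_ncard {C : Set (List ℕ)} (hC : C.Finite) (q) (m : ℕ)
    (h : ∀ w ∈ C, {p ∈ spl w | q p}.ncard = m) : (PS C q).ncard = m * C.ncard := by
  classical
  have hP := PS_fin hC q
  rw [Set.ncard_eq_toFinset_card _ hP, Set.ncard_eq_toFinset_card _ hC,
    Finset.card_eq_sum_card_fiberwise (f := fun p => p.1 ++ 0 :: p.2) (t := hC.toFinset)]
  · rw [Finset.sum_const_nat (m := m), mul_comm]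
    intro w hw
    rw [Set.Finite.mem_toFinset] at hw
    rw [← h w hw, ← Set.ncard_coe_finset]
    congr 1
    ext p
    simp only [Finset.coe_filter, Set.Finite.mem_toFinset, PS, spl, Set.mem_ofPred_eq]
    constructor
    · rintro ⟨⟨h1, h2⟩, h3⟩; exact ⟨h3, h2⟩
    · rintro ⟨h1, h2⟩; subst h1; exact ⟨⟨hw, h2⟩, rfl⟩
  · intro p hp
    simp only [Set.Finite.coe_toFinset] at hp ⊢
    exact hp.1

-- counting splits
lemma cnt_Z (w : List ℕ) : (Z w : Set ℕ).ncard = w.count 0 := by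
  rw [Set.ncard_coe_finset, card_Z]

lemma cnt_last {w : List ℕ} (h : w.getLast? = some 0) :
    w.length - 1 ∈ Z w := by
  rw [List.getLast?_eq_getElem?] at h
  have : w ≠ [] := by rintro rfl; simp at h
  have : 0 < w.length := List.length_pos_iff.2 this
  simp [Z, h]; omega

lemma ncard_all {w : List ℕ} : {p ∈ spl w | True}.ncard = w.count 0 := by
  rw [spl_ncard w (fun _ => True)]; simp [card_Z]

lemma ncard_A {w : List ℕ} (h : 0 ∈ Z w) : {p ∈ spl w | p.1 ≠ []}.ncard = w.count 0 - 1 := by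
  have : {p ∈ spl w | p.1 ≠ []} = {p ∈ spl w | (fun i => i ≠ 0) p.1.length} := by
    ext p; simp
  rw [this, spl_ncard w (fun i => i ≠ 0)]
  have : {i ∈ (Z w : Set ℕ) | i ≠ 0} = ((Z w).erase 0 : Finset ℕ) := by ext; simp
  rw [this, Set.ncard_coe_finset, Finset.card_erase_of_mem h, card_Z]

lemma ncard_B {w : List ℕ} (h : w.getLast? = some 0) :
    {p ∈ spl w | p.2 ≠ []}.ncard = w.count 0 - 1 := by
  have : {p ∈ spl w | p.2 ≠ []} = {p ∈ spl w | (fun i => i ≠ w.length - 1) p.1.length} := by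
    ext ⟨A, B⟩
    simp only [spl, Set.mem_ofPred_eq]
    refine and_congr_right fun e => ?_
    rw [← e, ← List.length_pos_iff]; simp only [List.length_append, List.length_cons]; omega
  rw [this, spl_ncard w (fun i => i ≠ w.length - 1)]
  have : {i ∈ (Z w : Set ℕ) | i ≠ w.length - 1} = ((Z w).erase (w.length - 1) : Finset ℕ) := by
    ext; simp [and_comm]
  rw [this, Set.ncard_coe_finset, Finset.card_erase_of_mem (cnt_last h), card_Z]

lemma ncard_AB {w : List ℕ} (h0 : 0 ∈ Z w) (h : w.getLast? = some 0) (h2 : 2 ≤ w.count 0) :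
    {p ∈ spl w | p.1 ≠ [] ∧ p.2 ≠ []}.ncard = w.count 0 - 2 := by
  have : {p ∈ spl w | p.1 ≠ [] ∧ p.2 ≠ []} =
      {p ∈ spl w | (fun i => i ≠ 0 ∧ i ≠ w.length - 1) p.1.length} := by
    ext ⟨A, B⟩
    simp only [spl, Set.mem_ofPred_eq]
    refine and_congr_right fun e => ?_
    rw [← e, ← List.length_pos_iff, ← List.length_pos_iff]
    simp only [List.length_append, List.length_cons]; omega
  rw [this, spl_ncard w (fun i => i ≠ 0 ∧ i ≠ w.length - 1)]
  have : {i ∈ (Z w : Set ℕ) | i ≠ 0 ∧ i ≠ w.length - 1}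
      = (((Z w).erase 0).erase (w.length - 1) : Finset ℕ) := by
    ext; simp; tauto
  have hl := List.count_le_length (a := 0) (l := w)
  rw [this, Set.ncard_coe_finset, Finset.card_erase_of_mem, Finset.card_erase_of_mem h0, card_Z]
  · omega
  · rw [Finset.mem_erase]; exact ⟨by omega, cnt_last h⟩


lemma chain_app (K : ℕ) (A B : List ℕ) (x : ℕ) : (K :: (A ++ x :: B)).IsChain r ↔
    (K :: A).IsChain r ∧ r (A.getLastD K) x ∧ (x :: B).IsChain r := by
  induction A generalizing K with
  | nil => simp
  | cons y A ih =>
    rw [List.cons_append, List.isChain_cons_cons, ih, List.isChain_cons_cons, List.getLastD_cons]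
    tauto

lemma la_mem {A : List ℕ} (K : ℕ) (h : A ≠ []) : A.getLastD K ∈ A := by
  rcases List.eq_nil_or_concat' A with rfl | ⟨A', a, rfl⟩
  · exact absurd rfl h
  · simp

lemma r_zero {a : ℕ} : r a 0 ↔ 0 < a := by simp [r]

lemma Cfg_mem {K T c w x} (h : w ∈ Cfg K T c) (hx : x ∈ w) : x = 0 ∨ x ∈ T := by
  have : x ∈ (w : Multiset ℕ) := by simpa using hx
  rw [h.1, Multiset.mem_add] at this
  rcases this with h | h
  · left; exact Multiset.eq_of_mem_replicate h
  · right; exact h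

lemma coe_mid (A B : List ℕ) (v : ℕ) :
    ((A ++ v :: B : List ℕ) : Multiset ℕ) = v ::ₘ ((A ++ B : List ℕ) : Multiset ℕ) :=
  Multiset.coe_eq_coe.2 List.perm_middle

lemma Cfg_count {K T c w} (h : w ∈ Cfg K T c) (h0 : 0 ∉ T) : w.count 0 = c := by
  rw [← Multiset.coe_count, h.1]; simp [h0]

section step
variable {K v : ℕ} {T : Multiset ℕ} {c : ℕ}

lemma r_la {w} {A : List ℕ} (hT : ∀ x ∈ T, v < x) (hw : w ∈ Cfg K T c) (hA : ∀ x ∈ A, x ∈ w)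
    (hq : A = [] → v < K) (h0 : r (A.getLastD K) 0) : r (A.getLastD K) v := by
  left
  by_cases h : A = []
  · subst h; simpa using hq rfl
  · rcases Cfg_mem hw (hA _ (la_mem K h)) with h1 | h1
    · rw [r_zero] at h0; omega
    · exact hT _ h1

lemma f1_mem (hv0 : 0 < v) (hT : ∀ x ∈ T, v < x) {A B : List ℕ}
    (h : A ++ 0 :: B ∈ Cfg K T c) (hq : A = [] → v < K) :
    A ++ v :: 0 :: B ∈ Cfg K (v ::ₘ T) c := by
  obtain ⟨h1, h2, h3⟩ := id h
  refine ⟨?_, ?_, ?_⟩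
  · rw [coe_mid, h1, Multiset.add_cons]
  · rw [List.getLast?_append] at h2 ⊢; simpa using h2
  · rw [chain_app] at h3 ⊢
    refine ⟨h3.1, r_la hT h (by simp; tauto) hq h3.2.1, ?_⟩
    rw [List.isChain_cons_cons]
    exact ⟨r_zero.2 hv0, h3.2.2⟩

lemma odd_eq (hv : Odd v) (hT : ∀ x ∈ T, v < x) :
    Cfg K (v ::ₘ T) c =
      (fun p : List ℕ × List ℕ => p.1 ++ v :: 0 :: p.2) '' PS (Cfg K T c) (fun p => p.1 = [] → v < K) ∪
      (fun p : List ℕ × List ℕ => p.1 ++ v :: p.2) ''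
        PS (Cfg K T (c + 1)) (fun p => (p.1 = [] → v < K) ∧ p.2 ≠ []) := by
  have hv0 : 0 < v := hv.pos
  ext w
  constructor
  · intro hw
    have hvw : v ∈ w := by
      have : v ∈ (w : Multiset ℕ) := by rw [hw.1]; simp
      simpa using this
    obtain ⟨A, X, rfl⟩ := List.append_of_mem hvw
    obtain ⟨h1, h2, h3⟩ := id hw
    rw [coe_mid, Multiset.add_cons, Multiset.cons_inj_right] at h1
    rcases X with _ | ⟨x, B⟩
    · simp at h2; omega
    rw [chain_app, List.isChain_cons_cons] at h3
    obtain ⟨h3, h4, h5, h6⟩ := h3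
    have h4' : v < A.getLastD K := by
      rcases h4 with h4 | h4
      · exact h4
      · exact absurd hv (Nat.not_odd_iff_even.2 h4.2.2)
    have hq : A = [] → v < K := by rintro rfl; simpa using h4'
    have hr0 : r (A.getLastD K) 0 := r_zero.2 (by omega)
    have hl : (x :: B).getLast? = some 0 := by
      rw [List.getLast?_append] at h2; simpa using h2
    by_cases hx : x = 0
    · subst hx
      left
      refine ⟨(A, B), ⟨⟨h1, ?_, ?_⟩, hq⟩, rfl⟩
      · rw [List.getLast?_append]; simpa using hl
      · rw [chain_app]; exact ⟨h3, hr0, h6⟩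
    · right
      have hxT : x ∈ T := by
        have : x ∈ ((A ++ x :: B : List ℕ) : Multiset ℕ) := by simp
        rw [h1, Multiset.mem_add] at this
        rcases this with h | h
        · exact absurd (Multiset.eq_of_mem_replicate h) hx
        · exact h
      have hvx := hT x hxT
      refine ⟨(A, x :: B), ⟨⟨?_, ?_, ?_⟩, hq, by simp⟩, rfl⟩
      · rw [coe_mid, h1, Multiset.replicate_succ, Multiset.cons_add]
      · rw [List.getLast?_append, List.getLast?_cons_cons]; simp [hl]
      · rw [chain_app, List.isChain_cons_cons]
        refine ⟨h3, hr0, Or.inr ⟨by omega, Or.inr rfl, ?_⟩, h6⟩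
        rcases h5 with h5 | h5
        · omega
        · exact h5.2.2
  · rintro (⟨⟨A, B⟩, ⟨h, hq⟩, rfl⟩ | ⟨⟨A, B⟩, ⟨h, hq, hB⟩, rfl⟩)
    · exact f1_mem hv0 hT h hq
    · obtain ⟨h1, h2, h3⟩ := id h
      simp only at h1 h2 h3 hq hB ⊢
      rcases B with _ | ⟨b, B⟩
      · exact absurd rfl hB
      have hbm := Cfg_mem h (x := b) (by simp)
      refine ⟨?_, ?_, ?_⟩
      · rw [coe_mid, Multiset.add_cons, Multiset.cons_inj_right]
        rwa [coe_mid, Multiset.replicate_succ, Multiset.cons_add, Multiset.cons_inj_right] at h1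
      · rw [List.getLast?_append, List.getLast?_cons_cons] at h2 ⊢; exact h2
      · rw [chain_app, List.isChain_cons_cons] at h3 ⊢
        refine ⟨h3.1, r_la hT h (by simp; tauto) hq h3.2.1, ?_, h3.2.2.2⟩
        rcases h3.2.2.1 with h5 | h5
        · omega
        · rcases hbm with rfl | hb
          · omega
          · exact Or.inr ⟨hT _ hb, Or.inl hv, h5.2.2⟩

lemma even_eq (hK : Even K) (hK0 : 0 < K) (hv : Even v) (hv0 : 0 < v) (hT : ∀ x ∈ T, v < x) :
    Cfg K (v ::ₘ T) (c + 1) =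
      (fun p : List ℕ × List ℕ => p.1 ++ v :: 0 :: p.2) ''
        PS (Cfg K T (c + 1)) (fun p => p.1 = [] → v < K) ∪
      (fun p : List ℕ × List ℕ => (p.1 ++ [0]) ++ v :: 0 :: p.2) ''
        PS (Cfg K T c) (fun _ => True) := by
  ext w
  constructor
  · intro hw
    have hvw : v ∈ w := by
      have : v ∈ (w : Multiset ℕ) := by rw [hw.1]; simp
      simpa using this
    obtain ⟨A, X, rfl⟩ := List.append_of_mem hvw
    obtain ⟨h1, h2, h3⟩ := id hw
    rw [coe_mid, Multiset.add_cons, Multiset.cons_inj_right] at h1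
    rcases X with _ | ⟨x, B⟩
    · simp at h2; omega
    have hmem : ∀ y ∈ A ++ x :: B, y = 0 ∨ y ∈ T := by
      intro y hy
      have : y ∈ ((A ++ x :: B : List ℕ) : Multiset ℕ) := by simpa using hy
      rw [h1, Multiset.mem_add] at this
      rcases this with h | h
      · exact Or.inl (Multiset.eq_of_mem_replicate h)
      · exact Or.inr h
    rw [chain_app, List.isChain_cons_cons] at h3
    obtain ⟨h3, h4, h5, h6⟩ := h3
    have hx : x = 0 := by
      rcases hmem x (by simp) with h | h
      · exact h
      · have := hT x h
        rcases h5 with h5 | ⟨-, h5 | h5, -⟩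
        · omega
        · exact absurd h5 (Nat.not_odd_iff_even.2 hv)
        · omega
    subst hx
    have hl : (0 :: B).getLast? = some 0 := by
      rw [List.getLast?_append] at h2; simpa using h2
    by_cases h4' : v < A.getLastD K
    · left
      refine ⟨(A, B), ⟨⟨h1, ?_, ?_⟩, ?_⟩, rfl⟩
      · rw [List.getLast?_append]; simp [hl]
      · rw [chain_app]; exact ⟨h3, r_zero.2 (hv0.trans h4'), h6⟩
      · rintro h
        simp only at h
        subst h; simpa using h4'
    · right
      have h5' : Odd (A.getLastD K) ∨ A.getLastD K = 0 := by
        rcases h4 with h | h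
        · exact absurd h h4'
        · exact h.2.1
      rcases List.eq_nil_or_concat' A with rfl | ⟨A', a, rfl⟩
      · simp at h5'
        rcases h5' with h | h
        · exact absurd h (Nat.not_odd_iff_even.2 hK)
        · omega
      · have ha : a = 0 := by
          rcases hmem a (by simp) with h | h
          · exact h
          · have := hT a h
            simp at h4'; omega
        subst ha
        rw [chain_app] at h3
        refine ⟨(A', B), ⟨⟨?_, ?_, ?_⟩, trivial⟩, rfl⟩
        · rw [coe_mid, List.append_assoc, List.singleton_append, Multiset.replicate_succ,
            Multiset.cons_add, Multiset.cons_inj_right] at h1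
          exact h1
        · rw [List.getLast?_append]; simp [hl]
        · rw [chain_app]; exact ⟨h3.1, h3.2.1, h6⟩
  · rintro (⟨⟨A, B⟩, ⟨h, hq⟩, rfl⟩ | ⟨⟨A, B⟩, ⟨h, -⟩, rfl⟩)
    · exact f1_mem hv0 hT h hq
    · obtain ⟨h1, h2, h3⟩ := id h
      simp only at h1 h2 h3 ⊢
      refine ⟨?_, ?_, ?_⟩
      · rw [coe_mid, Multiset.add_cons, Multiset.cons_inj_right, List.append_assoc,
          List.singleton_append, coe_mid, h1, Multiset.replicate_succ, Multiset.cons_add]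
      · have hl : (0 :: B).getLast? = some 0 := by
          rw [List.getLast?_append] at h2; simpa using h2
        rw [List.getLast?_append, List.getLast?_cons_cons, hl]; rfl
      · rw [chain_app] at h3
        rw [chain_app, chain_app, List.isChain_cons_cons]
        refine ⟨⟨h3.1, h3.2.1, by simp⟩, ?_, r_zero.2 hv0, h3.2.2⟩
        simp only [List.getLastD_concat]
        exact Or.inr ⟨hv0, Or.inr rfl, hv⟩

lemma notMem_of {A B : List ℕ} (hv0 : 0 < v) (hT : ∀ x ∈ T, v < x)
    (h : A ++ 0 :: B ∈ Cfg K T c) : v ∉ A ∧ v ∉ B := by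
  constructor <;> intro hm
  · rcases Cfg_mem h (x := v) (by simp [hm]) with h | h
    · omega
    · exact lt_irrefl _ (hT _ h)
  · rcases Cfg_mem h (x := v) (by simp [hm]) with h | h
    · omega
    · exact lt_irrefl _ (hT _ h)

lemma odd_card (hv : Odd v) (hT : ∀ x ∈ T, v < x) :
    (Cfg K (v ::ₘ T) c).ncard =
      (PS (Cfg K T c) (fun p => p.1 = [] → v < K)).ncard +
      (PS (Cfg K T (c + 1)) (fun p => (p.1 = [] → v < K) ∧ p.2 ≠ [])).ncard := by
  have hv0 : 0 < v := hv.pos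
  rw [odd_eq hv hT, Set.ncard_union_eq ?_ ((PS_fin (Cfg_fin _ _ _) _).image _)
    ((PS_fin (Cfg_fin _ _ _) _).image _), Set.InjOn.ncard_image, Set.InjOn.ncard_image]
  · rintro ⟨A, B⟩ ⟨h, -⟩ ⟨A', B'⟩ ⟨h', -⟩ e
    obtain ⟨n1, n2⟩ := notMem_of hv0 hT h
    dsimp only at e h h' n1 n2
    rw [List.append_cons_inj_of_notMem n1 n2] at e
    simp [e.1, e.2.2]
  · rintro ⟨A, B⟩ ⟨h, -⟩ ⟨A', B'⟩ ⟨h', -⟩ e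
    obtain ⟨n1, n2⟩ := notMem_of hv0 hT h
    dsimp only at e h h' n1 n2
    rw [List.append_cons_inj_of_notMem n1 (by simp [n2]; omega)] at e
    simpa [e.1] using e
  · rw [Set.disjoint_left]
    rintro _ ⟨⟨A, B⟩, ⟨h, -⟩, rfl⟩ ⟨⟨A', B'⟩, ⟨h', -⟩, e⟩
    obtain ⟨n1, n2⟩ := notMem_of hv0 hT h'
    dsimp only at e h h' n1 n2
    rw [List.append_cons_inj_of_notMem n1 n2] at e
    have := h'.2.2
    rw [e.2.2] at this
    rw [chain_app, List.isChain_cons_cons] at this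
    exact absurd (r_zero.1 this.2.2.1) (lt_irrefl _)

lemma even_card (hK : Even K) (hK0 : 0 < K) (hv : Even v) (hv0 : 0 < v) (hT : ∀ x ∈ T, v < x) :
    (Cfg K (v ::ₘ T) (c + 1)).ncard =
      (PS (Cfg K T (c + 1)) (fun p => p.1 = [] → v < K)).ncard +
      (PS (Cfg K T c) (fun _ => True)).ncard := by
  rw [even_eq hK hK0 hv hv0 hT, Set.ncard_union_eq ?_ ((PS_fin (Cfg_fin _ _ _) _).image _)
    ((PS_fin (Cfg_fin _ _ _) _).image _), Set.InjOn.ncard_image, Set.InjOn.ncard_image]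
  · rintro ⟨A, B⟩ ⟨h, -⟩ ⟨A', B'⟩ ⟨h', -⟩ e
    obtain ⟨n1, n2⟩ := notMem_of hv0 hT h
    dsimp only at e h h' n1 n2
    rw [List.append_cons_inj_of_notMem (by simp [n1]; omega) (by simp [n2]; omega)] at e
    simpa using e
  · rintro ⟨A, B⟩ ⟨h, -⟩ ⟨A', B'⟩ ⟨h', -⟩ e
    obtain ⟨n1, n2⟩ := notMem_of hv0 hT h
    dsimp only at e h h' n1 n2
    rw [List.append_cons_inj_of_notMem n1 (by simp [n2]; omega)] at e
    simpa [e.1] using e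
  · rw [Set.disjoint_left]
    rintro _ ⟨⟨A, B⟩, ⟨h, -⟩, rfl⟩ ⟨⟨A', B'⟩, ⟨h', -⟩, e⟩
    obtain ⟨n1, n2⟩ := notMem_of hv0 hT h'
    dsimp only at e h h' n1 n2
    rw [List.append_cons_inj_of_notMem (by simp [n1]; omega) (by simp [n2]; omega)] at e
    have := h.2.2
    rw [← e.1] at this
    rw [chain_app, List.getLastD_concat, r_zero] at this
    omega

lemma zero_mem_Z {w} (hK : Even K) (hK0 : 0 < K) (hKv : K < v) (hT : ∀ x ∈ T, v < x)
    (h : w ∈ Cfg K T c) : 0 ∈ Z w := by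
  rcases w with _ | ⟨x, w⟩
  · have := h.2.1; simp at this
  have h3 := h.2.2
  rw [List.isChain_cons_cons] at h3
  have hx : x < K := by
    rcases h3.1 with h | ⟨-, h | h, -⟩
    · exact h
    · exact absurd h (Nat.not_odd_iff_even.2 hK)
    · omega
  rcases Cfg_mem h (x := x) (by simp) with rfl | h
  · simp [Z]
  · have := hT x h; omega

lemma odd_lt (hv : Odd v) (hT : ∀ x ∈ T, v < x) (hvK : v < K) (d : ℕ) :
    (Cfg K (v ::ₘ T) (d + 1)).ncard =
      (d + 1) * (Cfg K T (d + 1)).ncard + (d + 1) * (Cfg K T (d + 2)).ncard := by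
  have h0 : 0 ∉ T := fun h => by have := hT 0 h; omega
  rw [odd_card hv hT]
  congr 1
  · apply PS_ncard (Cfg_fin _ _ _)
    intro w hw
    rw [← Cfg_count hw h0, ← ncard_all]
    simp [hvK]
  · apply PS_ncard (Cfg_fin _ _ _)
    intro w hw
    have := ncard_B hw.2.1
    rw [Cfg_count hw h0] at this
    simpa [hvK] using this

lemma odd_gt (hK : Even K) (hK0 : 0 < K) (hv : Odd v) (hT : ∀ x ∈ T, v < x) (hvK : K < v) (d : ℕ) :
    (Cfg K (v ::ₘ T) (d + 1)).ncard =
      d * (Cfg K T (d + 1)).ncard + d * (Cfg K T (d + 2)).ncard := by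
  have h0 : 0 ∉ T := fun h => by have := hT 0 h; omega
  have hn : ¬ v < K := by omega
  rw [odd_card hv hT]
  congr 1
  · apply PS_ncard (Cfg_fin _ _ _)
    intro w hw
    have := ncard_A (zero_mem_Z hK hK0 hvK hT hw)
    rw [Cfg_count hw h0] at this
    simpa [hn] using this
  · apply PS_ncard (Cfg_fin _ _ _)
    intro w hw
    have := ncard_AB (zero_mem_Z hK hK0 hvK hT hw) hw.2.1 (by rw [Cfg_count hw h0]; omega)
    rw [Cfg_count hw h0] at this
    simpa [hn] using this

lemma even_lt (hK : Even K) (hK0 : 0 < K) (hv : Even v) (hv0 : 0 < v) (hT : ∀ x ∈ T, v < x)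
    (hvK : v < K) (d : ℕ) :
    (Cfg K (v ::ₘ T) (d + 1)).ncard =
      (d + 1) * (Cfg K T (d + 1)).ncard + d * (Cfg K T d).ncard := by
  have h0 : 0 ∉ T := fun h => by have := hT 0 h; omega
  rw [even_card hK hK0 hv hv0 hT]
  congr 1
  · apply PS_ncard (Cfg_fin _ _ _)
    intro w hw
    rw [← Cfg_count hw h0, ← ncard_all]
    simp [hvK]
  · apply PS_ncard (Cfg_fin _ _ _)
    intro w hw
    rw [ncard_all, Cfg_count hw h0]

lemma even_gt (hK : Even K) (hK0 : 0 < K) (hv : Even v) (hv0 : 0 < v) (hT : ∀ x ∈ T, v < x)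
    (hvK : K < v) (d : ℕ) :
    (Cfg K (v ::ₘ T) (d + 1)).ncard =
      d * (Cfg K T (d + 1)).ncard + d * (Cfg K T d).ncard := by
  have h0 : 0 ∉ T := fun h => by have := hT 0 h; omega
  have hn : ¬ v < K := by omega
  rw [even_card hK hK0 hv hv0 hT]
  congr 1
  · apply PS_ncard (Cfg_fin _ _ _)
    intro w hw
    have := ncard_A (zero_mem_Z hK hK0 hvK hT hw)
    rw [Cfg_count hw h0] at this
    simpa [hn] using this
  · apply PS_ncard (Cfg_fin _ _ _)
    intro w hw
    rw [ncard_all, Cfg_count hw h0]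

end step
end Seid

namespace Seid

def Tm (K N v : ℕ) : Multiset ℕ := ((Finset.Icc v N).erase K).val

lemma Tm_gt {K N v x : ℕ} (h : x ∈ Tm K N (v + 1)) : v < x := by
  simp only [Tm, Finset.mem_val, Finset.mem_erase, Finset.mem_Icc] at h; omega

lemma Tm_ne {K N v : ℕ} (h : v ≠ K) (hv : v ≤ N) : Tm K N v = v ::ₘ Tm K N (v + 1) := by
  have : (Finset.Icc v N).erase K = Finset.cons v ((Finset.Icc (v + 1) N).erase K) (by simp) := by
    ext x; simp only [Finset.mem_cons, Finset.mem_erase, Finset.mem_Icc]; omega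
  rw [Tm, this, Finset.cons_val]; rfl

lemma Tm_self {K N : ℕ} : Tm K N K = Tm K N (K + 1) := by
  have : (Finset.Icc K N).erase K = (Finset.Icc (K + 1) N).erase K := by
    ext x; simp only [Finset.mem_cons, Finset.mem_erase, Finset.mem_Icc]; omega
  rw [Tm, this]; rfl

noncomputable def Hv (K N v : ℕ) : V := fun d => ((Cfg K (Tm K N v) (d + 1)).ncard : ℤ)

lemma Hv_top {K N : ℕ} (hK0 : 0 < K) (hN : K ≤ N) : Hv K N (N + 1) = de := by
  have hT : Tm K N (N + 1) = 0 := by simp [Tm]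
  ext d
  rw [Hv, hT]
  rcases d with _ | d
  · have : Cfg K 0 (0 + 1) = {[0]} := by
      ext w
      constructor
      · intro h
        have := h.1
        simpa using this
      · rintro rfl
        refine ⟨by simp, by simp, by simp [r_zero, hK0]⟩
    rw [this]; simp [de]
  · have : Cfg K 0 (d + 1 + 1) = ∅ := by
      ext w
      simp only [Set.mem_empty_iff_false, iff_false]
      intro h
      have h1 := h.1
      rw [add_zero, ← Multiset.coe_replicate, Multiset.coe_eq_coe, List.perm_replicate] at h1
      have h2 := h.2.2
      rw [h1, List.replicate_succ, List.replicate_succ, List.isChain_cons_cons,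
        List.isChain_cons_cons, r_zero, r_zero] at h2
      omega
    rw [this]; simp [de]

section
variable {K N v : ℕ}

lemma Hv_odd_lt (hv : Odd v) (hvN : v ≤ N) (h : v < K) : Hv K N v = Om (Hv K N (v + 1)) := by
  ext d
  rw [Om_apply, Hv, Tm_ne (by omega) hvN, odd_lt hv (fun _ => Tm_gt) h]
  simp [Hv]

lemma Hv_odd_gt (hK : Even K) (hK0 : 0 < K) (hv : Odd v) (hvN : v ≤ N) (h : K < v) :
    Hv K N v = Ou (Hv K N (v + 1)) := by
  ext d
  rw [Ou_apply, Hv, Tm_ne (by omega) hvN, odd_gt hK hK0 hv (fun _ => Tm_gt) h]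
  simp [Hv]

lemma Hv_even_lt (hK : Even K) (hK0 : 0 < K) (hv : Even v) (hv0 : 0 < v) (hvN : v ≤ N)
    (h : v < K) : Hv K N v = Em (Hv K N (v + 1)) := by
  ext d
  rw [Em_apply, Hv, Tm_ne (by omega) hvN, even_lt hK hK0 hv hv0 (fun _ => Tm_gt) h]
  rcases d with _ | d <;> simp [Hv]

lemma Hv_even_gt (hK : Even K) (hK0 : 0 < K) (hv : Even v) (hv0 : 0 < v) (hvN : v ≤ N)
    (h : K < v) : Hv K N v = Eu (Hv K N (v + 1)) := by
  ext d
  rw [Eu_apply, Hv, Tm_ne (by omega) hvN, even_gt hK hK0 hv hv0 (fun _ => Tm_gt) h]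
  rcases d with _ | d <;> simp [Hv]

lemma Hv_self : Hv K N K = Hv K N (K + 1) := by
  unfold Hv; rw [Tm_self]
end

lemma Hv_phase1 (i j : ℕ) : ∀ t ≤ j, Hv (2 * (i + 1)) (2 * (i + 1 + j)) (2 * (i + 1 + (j - t)) + 1)
    = ((Ou * Eu) ^ t) de := by
  intro t
  induction t with
  | zero => intro _; simpa using Hv_top (by omega) (by omega)
  | succ t ih =>
    intro ht
    have h := ih (by omega)
    obtain ⟨s, hs⟩ : ∃ s, j - t = s + 1 := ⟨j - t - 1, by omega⟩
    rw [show j - (t + 1) = s by omega]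
    rw [hs] at h
    rw [Hv_odd_gt (even_two_mul _) (by omega) ⟨_, rfl⟩ (by omega) (by omega),
      Hv_even_gt (even_two_mul _) (by omega) ⟨i + 1 + s + 1, by ring⟩ (by omega) (by omega) (by omega),
      show 2 * (i + 1 + s) + 1 + 1 + 1 = 2 * (i + 1 + (s + 1)) + 1 by ring, h, pow_succ']
    rfl

lemma Hv_phase2 (i j : ℕ) : ∀ t ≤ i, Hv (2 * (i + 1)) (2 * (i + 1 + j)) (2 * (i - t) + 1)
    = ((Om * Em) ^ t * Om * (Ou * Eu) ^ j) de := by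
  intro t
  induction t with
  | zero =>
    intro _
    have h := Hv_phase1 i j j le_rfl
    rw [Hv_odd_lt ⟨_, rfl⟩ (by omega) (by omega),
      show 2 * (i - 0) + 1 + 1 = 2 * (i + 1) by omega, Hv_self]
    simp only [Nat.sub_self, add_zero] at h
    rw [h]; simp
  | succ t ih =>
    intro ht
    have h := ih (by omega)
    obtain ⟨s, hs⟩ : ∃ s, i - t = s + 1 := ⟨i - t - 1, by omega⟩
    rw [show i - (t + 1) = s by omega]
    rw [hs] at h
    rw [Hv_odd_lt ⟨_, rfl⟩ (by omega) (by omega),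
      Hv_even_lt (even_two_mul _) (by omega) ⟨s + 1, by ring⟩ (by omega) (by omega) (by omega),
      show 2 * s + 1 + 1 + 1 = 2 * (s + 1) + 1 by ring, h, pow_succ']
    simp only [mul_assoc]
    rfl

lemma cfg_a (i j : ℕ) :
    ((Cfg (2 * (i + 1)) (Tm (2 * (i + 1)) (2 * (i + 1 + j)) 1) 1).ncard : ℤ) = a i j := by
  have := congrFun (Hv_phase2 i j i le_rfl) 0
  simp only [Nat.sub_self, mul_zero, zero_add, Hv] at this
  exact this

def L {N : ℕ} (π : Equiv.Perm (Fin N)) : List ℕ := List.ofFn fun i => (π i : ℕ) + 1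

lemma L_coe {N : ℕ} (π : Equiv.Perm (Fin N)) : (L π : Multiset ℕ) = (Finset.Icc 1 N).val := by
  apply (Multiset.Nodup.ext ?_ (Finset.Icc 1 N).nodup).2
  · intro x
    simp only [L, Multiset.mem_coe, List.mem_ofFn, Set.mem_range, Finset.mem_val, Finset.mem_Icc]
    constructor
    · rintro ⟨i, rfl⟩
      have := (π i).2
      omega
    · rintro ⟨h1, h2⟩
      exact ⟨π.symm ⟨x - 1, by omega⟩, by simp; omega⟩
  · rw [Multiset.coe_nodup, L, List.nodup_ofFn]
    intro i j h
    apply π.injective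
    apply Fin.ext
    simpa using h

lemma L_inj {N : ℕ} {π ρ : Equiv.Perm (Fin N)} (h : L π = L ρ) : π = ρ := by
  have := List.ofFn_injective h
  ext i
  have := congrFun this i
  simpa using this

lemma L_surj {N : ℕ} {l : List ℕ} (h : (l : Multiset ℕ) = (Finset.Icc 1 N).val) :
    ∃ π : Equiv.Perm (Fin N), L π = l := by
  have hlen : l.length = N := by
    have := congrArg Multiset.card h
    simpa using this
  have hnd : l.Nodup := by
    rw [← Multiset.coe_nodup, h]; exact (Finset.Icc 1 N).nodup
  have hm : ∀ x ∈ l, 1 ≤ x ∧ x ≤ N := by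
    intro x hx
    have : x ∈ (l : Multiset ℕ) := by simpa using hx
    rw [h] at this
    simpa using this
  have hb : ∀ i : Fin N, 1 ≤ l[(i : ℕ)]'(by omega) ∧ l[(i : ℕ)]'(by omega) ≤ N :=
    fun i => hm _ (List.getElem_mem _)
  let g : Fin N → Fin N := fun i => ⟨l[(i : ℕ)]'(by omega) - 1, by have := hb i; omega⟩
  have hg : Function.Injective g := by
    intro i j e
    simp only [g, Fin.mk.injEq] at e
    have h1 := hb i
    have h2 := hb j
    have : l[(i : ℕ)]'(by omega) = l[(j : ℕ)]'(by omega) := by omega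
    rw [hnd.getElem_inj_iff] at this
    exact Fin.ext this
  refine ⟨Equiv.ofBijective g (Finite.injective_iff_bijective.1 hg), ?_⟩
  apply List.ext_getElem
  · simp [L, hlen]
  · intro i h1 h2
    have := hb ⟨i, by omega⟩
    simp only [L, List.getElem_ofFn, Equiv.ofBijective_apply, g]
    dsimp only at this
    omega

lemma L_chain {N : ℕ} (π : Equiv.Perm (Fin N)) : IsGI π ↔ (L π).IsChain r := by
  rw [List.isChain_iff_getElem]
  constructor
  · intro h i hi
    have hi' : i + 1 < N := by simpa [L] using hi
    simp only [L, List.getElem_ofFn]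
    have := h ⟨i, by omega⟩ ⟨i + 1, hi'⟩ rfl
    rcases lt_trichotomy (π ⟨i, by omega⟩) (π ⟨i + 1, hi'⟩) with hlt | heq | hgt
    · right
      obtain ⟨h1, h2⟩ := this hlt
      exact ⟨by have := Fin.lt_def.1 hlt; omega, Or.inl h1, h2⟩
    · have := π.injective heq
      simp at this
    · left; have := Fin.lt_def.1 hgt; omega
  · rintro h ⟨i, hi⟩ ⟨j, hj⟩ hij hlt
    simp only at hij
    subst hij
    have := h i (by simpa [L] using hj)
    simp only [L, List.getElem_ofFn] at this
    have hlt' := Fin.lt_def.1 hlt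
    rcases this with h | ⟨-, h | h, h'⟩
    · omega
    · exact ⟨h, h'⟩
    · omega

lemma L_first {N : ℕ} (hN : 0 < N) (π : Equiv.Perm (Fin N)) (K : ℕ) :
    FirstIs π K ↔ ∃ u, L π = K :: u := by
  obtain ⟨M, rfl⟩ : ∃ M, N = M + 1 := ⟨N - 1, by omega⟩
  rw [L, List.ofFn_succ]
  constructor
  · intro h
    exact ⟨_, by rw [h 0 rfl]⟩
  · rintro ⟨u, h⟩ i hi
    rw [List.cons.injEq] at h
    obtain rfl : i = 0 := Fin.ext hi
    exact h.1

lemma card_link {N K : ℕ} (hK0 : 0 < K) (hKN : K ≤ N) :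
    Nat.card {π : Equiv.Perm (Fin N) // IsGI π ∧ FirstIs π K} = (Cfg K (Tm K N 1) 1).ncard := by
  have hT : K ::ₘ Tm K N 1 = (Finset.Icc 1 N).val := by
    rw [Tm, Finset.erase_val, Multiset.cons_erase]
    simp; omega
  have himg : Cfg K (Tm K N 1) 1 = (fun π : Equiv.Perm (Fin N) => (L π).tail ++ [0]) ''
      {π | IsGI π ∧ FirstIs π K} := by
    ext w
    constructor
    · rintro ⟨h1, h2, h3⟩
      rcases List.eq_nil_or_concat' w with rfl | ⟨u, z, rfl⟩
      · simp at h2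
      obtain rfl : z = 0 := by simpa using h2
      rw [coe_mid, List.append_nil] at h1
      have h1' : (u : Multiset ℕ) = Tm K N 1 := by
        rwa [Multiset.replicate_one, Multiset.singleton_add, Multiset.cons_inj_right] at h1
      obtain ⟨π, hπ⟩ := L_surj (N := N) (l := K :: u) (by rw [← hT, ← h1']; rfl)
      rw [chain_app] at h3
      refine ⟨π, ⟨?_, ?_⟩, ?_⟩
      · rw [L_chain, hπ]; exact h3.1
      · rw [L_first (by omega)]; exact ⟨u, hπ⟩
      · simp [hπ]
    · rintro ⟨π, ⟨h1, h2⟩, rfl⟩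
      obtain ⟨u, hu⟩ := (L_first (by omega) π K).1 h2
      rw [L_chain, hu] at h1
      have hc := L_coe π
      rw [hu, ← hT, ← Multiset.cons_coe, Multiset.cons_inj_right] at hc
      simp only [hu, List.tail_cons]
      refine ⟨?_, by simp, ?_⟩
      · rw [coe_mid, List.append_nil, hc]; simp
      · rw [chain_app]
        refine ⟨h1, ?_, by simp⟩
        rw [r_zero]
        by_cases hu0 : u = []
        · subst hu0; simpa using hK0
        · have : u.getLastD K ∈ (u : Multiset ℕ) := by simpa using la_mem K hu0
          rw [hc] at this
          exact Tm_gt this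
  rw [himg, Set.InjOn.ncard_image]
  · rfl
  · rintro π ⟨-, h⟩ ρ ⟨-, h'⟩ e
    obtain ⟨u, hu⟩ := (L_first (by omega) π K).1 h
    obtain ⟨u', hu'⟩ := (L_first (by omega) ρ K).1 h'
    simp only [hu, hu', List.tail_cons, List.append_cancel_right_eq] at e
    exact L_inj (by rw [hu, hu', e])

end Seid

/-- For all `n ≥ 1` and `1 ≤ k ≤ n`, `|G^I_{2n,2k}| = S(2n, n+1-k)`, where `S`
is the Seidel triangle: `S(1,1) = 1`, `S(r,k) = 0` for `k < 1` or `k > ⌈r/2⌉`,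
`S(2m,k) = S(2m-1,k) + S(2m,k+1)`, and `S(2m+1,k) = S(2m,k) + S(2m+1,k-1)`. -/
theorem card_GI_first_even_eq_seidel
    (S : ℕ → ℕ → ℕ)
    (hS1 : S 1 1 = 1)
    (hS0 : ∀ r, 1 ≤ r → S r 0 = 0)
    (hStop : ∀ r k, 1 ≤ r → r + 1 < 2 * k → S r k = 0)
    (hSeven : ∀ m k, 1 ≤ m → 1 ≤ k →
      S (2 * m) k = S (2 * m - 1) k + S (2 * m) (k + 1))
    (hSodd : ∀ m k, 1 ≤ m → 1 ≤ k → k ≤ m + 1 →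
      S (2 * m + 1) k = S (2 * m) k + S (2 * m + 1) (k - 1))
    (n k : ℕ) (hn : 1 ≤ n) (hk1 : 1 ≤ k) (hkn : k ≤ n) :
    Nat.card {π : Equiv.Perm (Fin (2 * n)) // IsGI π ∧ FirstIs π (2 * k)} =
      S (2 * n) (n + 1 - k) := by
  obtain ⟨i, rfl⟩ : ∃ i, k = i + 1 := ⟨k - 1, by omega⟩
  obtain ⟨j, rfl⟩ : ∃ j, n = i + 1 + j := ⟨n - (i + 1), by omega⟩
  rw [Seid.card_link (by omega) (by omega)]
  have h1 := Seid.cfg_a i j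
  rw [Seid.seidel_eq S hS1 hS0 hStop hSeven hSodd (i + j) i j rfl] at h1
  have h2 := Int.natCast_inj.1 h1
  rw [h2]
  congr 1 <;> omega
end
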